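/- arXiv:2101.08610 — 3 statements merged into one kernel-verified Lean document; each statement's English description precedes it below -/
import Mathlib

section
/- For all real x ≥ 3, the sum over integers n with x/2 < n ≤ x - 1.5 of Λ(n)/(x/n - 1) is at most r₃(x), where r₃(x) := x log x · ( (2/3)(4 + 1/log 2) + 2 log log x + 2/log x + (16/15) log(log x / log 2) + (π²/6 - 1)·( 2/(1 + √(x-1.5) - √x) - (1/√x)(1 - log((√2-1)/(√2+1))) ) ). -/
open Real Finset ArithmeticFunction

/-- The explicit bound `r₃(x)` of the paper. -/
noncomputable def r3 (x : ℝ) : ℝ :=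
  x * Real.log x *
    ((2 / 3) * (4 + 1 / Real.log 2) + 2 * Real.log (Real.log x) + 2 / Real.log x
      + (16 / 15) * Real.log (Real.log x / Real.log 2)
      + (Real.pi ^ 2 / 6 - 1) *
          (2 / (1 + Real.sqrt (x - 1.5) - Real.sqrt x)
            - (1 / Real.sqrt x) *
                (1 - Real.log ((Real.sqrt 2 - 1) / (Real.sqrt 2 + 1)))))


open scoped ArithmeticFunction.Moebius in
/-- Möbius inversion over the divisors of `m` that are multiples of `l`. -/
theorem sum_moebius_dvd_dvd {l m : ℕ} (hm : Squarefree m) (hlm : l ∣ m) :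
    ∑ d ∈ m.divisors with l ∣ d, (μ d : ℝ) = if m = l then (μ l : ℝ) else 0 := by
  obtain ⟨k, rfl⟩ := hlm
  have hcop := Nat.coprime_of_squarefree_mul hm
  have hl : l ≠ 0 := fun h => hm.ne_zero (by simp [h])
  have hk : k ≠ 0 := fun h => hm.ne_zero (by simp [h])
  have himg : (l * k).divisors.filter (l ∣ ·) = k.divisors.image (l * ·) := by
    ext d
    simp only [mem_filter, Nat.mem_divisors, mem_image]
    constructor
    · rintro ⟨⟨hd, -⟩, e, rfl⟩
      exact ⟨e, ⟨Nat.dvd_of_mul_dvd_mul_left (Nat.pos_of_ne_zero hl) hd, hk⟩, rfl⟩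
    · rintro ⟨e, ⟨he, -⟩, rfl⟩
      exact ⟨⟨Nat.mul_dvd_mul_left l he, mul_ne_zero hl hk⟩, dvd_mul_right _ _⟩
  rw [himg, sum_image (fun a _ b _ h => Nat.eq_of_mul_eq_mul_left (Nat.pos_of_ne_zero hl) h)]
  have hmul : ∀ e ∈ k.divisors, ((μ (l * e) : ℤ) : ℝ) = (μ l : ℝ) * (μ e : ℝ) := by
    intro e he
    rw [isMultiplicative_moebius.map_mul_of_coprime
      (hcop.coprime_dvd_right (Nat.dvd_of_mem_divisors he))]
    push_cast; rfl
  rw [sum_congr rfl hmul, ← mul_sum]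
  have hone : ∑ e ∈ k.divisors, (μ e : ℝ) = if k = 1 then 1 else 0 := by
    have := congrArg (fun f : ArithmeticFunction ℤ => f k) moebius_mul_coe_zeta
    simp only [coe_mul_zeta_apply, one_apply] at this
    exact_mod_cast this
  rw [hone]
  by_cases h : k = 1
  · simp [h]
  · have : l * k ≠ l := fun h' => h (by simpa [hl] using h')
    simp [h, this]

namespace BoundingSieve

open scoped ArithmeticFunction.Moebius

variable {s : BoundingSieve}

/-- The Selberg sum `∑ g(l)` over `l ∣ P` with `l ≤ R`. -/
noncomputable def selbergSum (s : BoundingSieve) (R : ℕ) : ℝ :=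
  ∑ l ∈ s.prodPrimes.divisors with l ≤ R, s.selbergTerms l

/-- The optimal weights of the Selberg sieve of level `R ^ 2`. -/
noncomputable def selbergWeight (s : BoundingSieve) (R : ℕ) (d : ℕ) : ℝ :=
  (μ d : ℝ) * (s.nu d)⁻¹ *
    (∑ l ∈ s.prodPrimes.divisors with l ≤ R ∧ d ∣ l, s.selbergTerms l) / s.selbergSum R

theorem selbergSum_pos {R : ℕ} (hR : 1 ≤ R) : 0 < s.selbergSum R := by
  refine sum_pos (fun l hl => selbergTerms_pos ?_) ⟨1, ?_⟩
  · exact Nat.dvd_of_mem_divisors (mem_filter.mp hl).1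
  · simp [hR, prodPrimes_ne_zero]

theorem selbergWeight_one {R : ℕ} (hR : 1 ≤ R) : s.selbergWeight R 1 = 1 := by
  have h := (selbergSum_pos (s := s) hR).ne'
  simp only [selbergWeight, one_dvd, and_true, s.nu_mult.map_one, moebius_apply_one]
  rw [← selbergSum]
  field_simp
  simp

theorem selbergWeight_eq_zero {R d : ℕ} (hd : R < d) : s.selbergWeight R d = 0 := by
  have : (s.prodPrimes.divisors.filter fun l => l ≤ R ∧ d ∣ l) = ∅ := by
    refine filter_eq_empty_iff.mpr fun l hl h => ?_
    have := Nat.le_of_dvd (Nat.pos_of_mem_divisors hl) h.2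
    omega
  simp [selbergWeight, this]

theorem abs_selbergWeight_le_one {R d : ℕ} (hR : 1 ≤ R) (hd : d ∣ s.prodPrimes) :
    |s.selbergWeight R d| ≤ 1 := by
  have hG := selbergSum_pos (s := s) hR
  have hν := nu_pos_of_dvd_prodPrimes hd
  have hg := selbergTerms_pos hd
  have hterm : ∀ l ∈ s.prodPrimes.divisors, 0 ≤ s.selbergTerms l := fun l hl =>
    (selbergTerms_pos (Nat.dvd_of_mem_divisors hl)).le
  have hμ : |(μ d : ℝ)| = 1 := by
    exact_mod_cast abs_moebius_eq_one_of_squarefree (squarefree_of_dvd_prodPrimes hd)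
  have hd0 : 0 < d := Nat.pos_of_ne_zero (squarefree_of_dvd_prodPrimes hd).ne_zero
  rw [selbergWeight, abs_div, abs_mul, abs_mul, hμ, one_mul, abs_of_pos hG, div_le_one hG,
    abs_of_pos (inv_pos.mpr hν),
    abs_of_nonneg (sum_nonneg fun l hl => hterm l (mem_filter.mp hl).1)]
  have hinv : (s.nu d)⁻¹ = (s.selbergTerms d)⁻¹ * ∑ k ∈ d.divisors, s.selbergTerms k := by
    have h := sum_divisors_selbergTerms_eq_selbergTerms_mul_nu_inv hd
    rw [← sum_filter, Nat.divisors_filter_dvd_of_dvd prodPrimes_ne_zero hd] at h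
    rw [h]; field_simp
  have hfact : ∀ l ∈ s.prodPrimes.divisors.filter (fun l => l ≤ R ∧ d ∣ l), ∀ k ∈ d.divisors,
      (s.selbergTerms d)⁻¹ * (s.selbergTerms k * s.selbergTerms l) =
        s.selbergTerms (k * (l / d)) := by
    intro l hl k hk
    simp only [mem_filter, Nat.mem_divisors] at hl
    obtain ⟨⟨hlP, -⟩, -, e, rfl⟩ := hl
    have hcop := Nat.coprime_of_squarefree_mul (squarefree_of_dvd_prodPrimes hlP)
    rw [Nat.mul_div_cancel_left _ hd0, selbergTerms_isMultiplicative.map_mul_of_coprime hcop,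
      selbergTerms_isMultiplicative.map_mul_of_coprime
        (hcop.coprime_dvd_left (Nat.dvd_of_mem_divisors hk))]
    field_simp
  have hexp : (s.nu d)⁻¹ * ∑ l ∈ s.prodPrimes.divisors with l ≤ R ∧ d ∣ l, s.selbergTerms l =
      ∑ x ∈ (s.prodPrimes.divisors.filter (fun l => l ≤ R ∧ d ∣ l)) ×ˢ d.divisors,
        s.selbergTerms (x.2 * (x.1 / d)) := by
    rw [sum_product, hinv, mul_sum]
    refine sum_congr rfl fun l hl => ?_
    rw [mul_assoc, sum_mul, mul_sum]
    exact sum_congr rfl fun k hk => hfact l hl k hk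
  have hinj : Set.InjOn (fun x : ℕ × ℕ => x.2 * (x.1 / d))
      ((s.prodPrimes.divisors.filter (fun l => l ≤ R ∧ d ∣ l)) ×ˢ d.divisors : Finset (ℕ × ℕ)) := by
    have key : ∀ l k, l ∣ s.prodPrimes → d ∣ l → k ∣ d → Nat.gcd d (k * (l / d)) = k := by
      rintro l k hlP ⟨e, rfl⟩ hk
      have hcop := Nat.coprime_of_squarefree_mul (squarefree_of_dvd_prodPrimes hlP)
      rw [Nat.mul_div_cancel_left _ hd0, Nat.Coprime.gcd_mul_right_cancel_right _ hcop.symm,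
        Nat.gcd_eq_right hk]
    rintro ⟨l, k⟩ h ⟨l', k'⟩ h' heq
    simp only [coe_product, Set.mem_prod, mem_coe, mem_filter, Nat.mem_divisors] at h h'
    simp only at heq
    have e1 := key l k h.1.1.1 h.1.2.2 h.2.1
    have e2 := key l' k' h'.1.1.1 h'.1.2.2 h'.2.1
    have hk : k = k' := by rw [← e1, ← e2, heq]
    subst hk
    have hk0 : 0 < k := Nat.pos_of_dvd_of_pos h.2.1 hd0
    have := Nat.eq_of_mul_eq_mul_left hk0 heq
    have hl : l = l' := by
      rw [← Nat.div_mul_cancel h.1.2.2, ← Nat.div_mul_cancel h'.1.2.2, this]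
    rw [hl]
  rw [hexp, ← sum_image (f := s.selbergTerms) hinj, selbergSum]
  refine sum_le_sum_of_subset_of_nonneg ?_ fun l hl _ => hterm l (mem_filter.mp hl).1
  intro n hn
  simp only [mem_image, mem_product, mem_filter, Nat.mem_divisors, Prod.exists] at hn ⊢
  obtain ⟨l, k, ⟨⟨⟨hlP, -⟩, hlR, hdl⟩, hk, -⟩, rfl⟩ := hn
  have hdvd : k * (l / d) ∣ l := by
    calc k * (l / d) ∣ d * (l / d) := Nat.mul_dvd_mul_right hk _
      _ = l := Nat.mul_div_cancel' hdl
  have hl0 : 0 < l := Nat.pos_of_ne_zero (squarefree_of_dvd_prodPrimes hlP).ne_zero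
  exact ⟨⟨hdvd.trans hlP, prodPrimes_ne_zero⟩, (Nat.le_of_dvd hl0 hdvd).trans hlR⟩

theorem sum_nu_mul_selbergWeight {R l : ℕ} (hl : l ∣ s.prodPrimes) :
    ∑ d ∈ s.prodPrimes.divisors, (if l ∣ d then s.nu d * s.selbergWeight R d else 0) =
      if l ≤ R then (μ l : ℝ) * s.selbergTerms l / s.selbergSum R else 0 := by
  have hP : s.prodPrimes ≠ 0 := prodPrimes_ne_zero
  calc ∑ d ∈ s.prodPrimes.divisors, (if l ∣ d then s.nu d * s.selbergWeight R d else 0)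
      = ∑ d ∈ s.prodPrimes.divisors, ∑ m ∈ s.prodPrimes.divisors,
          if l ∣ d ∧ m ≤ R ∧ d ∣ m then (μ d : ℝ) * s.selbergTerms m / s.selbergSum R else 0 := by
        refine sum_congr rfl fun d hd => ?_
        have hν := (nu_pos_of_dvd_prodPrimes (Nat.dvd_of_mem_divisors hd)).ne'
        by_cases h : l ∣ d
        · simp only [h, if_true, true_and]
          rw [← sum_filter, ← sum_div, ← mul_sum, selbergWeight]
          field_simp
        · simp [h]
    _ = ∑ m ∈ s.prodPrimes.divisors, ∑ d ∈ s.prodPrimes.divisors,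
          if l ∣ d ∧ m ≤ R ∧ d ∣ m then (μ d : ℝ) * s.selbergTerms m / s.selbergSum R else 0 :=
        sum_comm
    _ = ∑ m ∈ s.prodPrimes.divisors,
          if m = l then (if m ≤ R then (μ l : ℝ) * s.selbergTerms m / s.selbergSum R else 0)
          else 0 := by
        refine sum_congr rfl fun m hm => ?_
        have hmP := Nat.dvd_of_mem_divisors hm
        by_cases hmR : m ≤ R
        · simp only [hmR, true_and, if_true]
          have : ∑ d ∈ s.prodPrimes.divisors,
              (if l ∣ d ∧ d ∣ m then (μ d : ℝ) * s.selbergTerms m / s.selbergSum R else 0) =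
              (∑ d ∈ m.divisors with l ∣ d, (μ d : ℝ)) * (s.selbergTerms m / s.selbergSum R) := by
            rw [sum_mul, ← Nat.divisors_filter_dvd_of_dvd hP hmP, filter_filter, sum_filter]
            refine sum_congr rfl fun d _ => ?_
            simp only [and_comm, mul_div_assoc]
          rw [this]
          by_cases hlm : l ∣ m
          · rw [sum_moebius_dvd_dvd (squarefree_of_dvd_prodPrimes hmP) hlm]
            split_ifs <;> ring
          · have h1 : m ≠ l := fun h => hlm (h ▸ dvd_rfl)
            have h2 : m.divisors.filter (l ∣ ·) = ∅ :=
              filter_eq_empty_iff.mpr fun d hd h => hlm (h.trans (Nat.dvd_of_mem_divisors hd))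
            simp [h1, h2]
        · simp [hmR]
    _ = _ := by
        rw [sum_ite_eq' _ l, if_pos (Nat.mem_divisors.mpr ⟨hl, hP⟩)]

theorem mainSum_selbergWeight {R : ℕ} (hR : 1 ≤ R) :
    s.mainSum (lambdaSquared (s.selbergWeight R)) = (s.selbergSum R)⁻¹ := by
  have hG := (selbergSum_pos (s := s) hR).ne'
  rw [mainSum_lambdaSquared_eq_sum_mul_sum_sq]
  have : ∀ l ∈ s.prodPrimes.divisors, (s.selbergTerms l)⁻¹ *
      (∑ d ∈ s.prodPrimes.divisors, if l ∣ d then s.nu d * s.selbergWeight R d else 0) ^ 2 =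
      if l ≤ R then s.selbergTerms l * (s.selbergSum R ^ 2)⁻¹ else 0 := by
    intro l hl
    have hlP := Nat.dvd_of_mem_divisors hl
    have hg := (selbergTerms_pos hlP).ne'
    have hμ : (μ l : ℝ) ^ 2 = 1 := by
      exact_mod_cast moebius_sq_eq_one_of_squarefree (squarefree_of_dvd_prodPrimes hlP)
    rw [sum_nu_mul_selbergWeight hlP]
    split_ifs
    · rw [div_pow, mul_pow, hμ]; field_simp
    · simp
  rw [sum_congr rfl this, ← sum_filter, ← sum_mul, ← selbergSum]
  field_simp

theorem errSum_selbergWeight_le {R : ℕ} (hR : 1 ≤ R)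
    (hrem : ∀ d ∈ s.prodPrimes.divisors, |s.rem d| ≤ 1) :
    s.errSum (lambdaSquared (s.selbergWeight R)) ≤ (R : ℝ) ^ 2 := by
  have hP : s.prodPrimes ≠ 0 := prodPrimes_ne_zero
  set w := s.selbergWeight R with hw
  have hsum : ∑ d ∈ s.prodPrimes.divisors, |w d| ≤ R := by
    calc ∑ d ∈ s.prodPrimes.divisors, |w d|
        ≤ ∑ d ∈ s.prodPrimes.divisors, if d ≤ R then (1 : ℝ) else 0 := by
          refine sum_le_sum fun d hd => ?_
          split_ifs with h
          · exact abs_selbergWeight_le_one hR (Nat.dvd_of_mem_divisors hd)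
          · rw [hw, selbergWeight_eq_zero (not_le.mp h), abs_zero]
      _ = (#(s.prodPrimes.divisors.filter (· ≤ R)) : ℝ) := by simp
      _ ≤ (#(Icc 1 R) : ℝ) := by
          refine Nat.cast_le.mpr (card_le_card fun d hd => ?_)
          simp only [mem_filter] at hd
          exact mem_Icc.mpr ⟨Nat.pos_of_mem_divisors hd.1, hd.2⟩
      _ = R := by simp
  calc s.errSum (lambdaSquared w)
      ≤ ∑ d ∈ s.prodPrimes.divisors, |lambdaSquared w d| := by
        refine sum_le_sum fun d hd => ?_
        exact mul_le_of_le_one_right (abs_nonneg _) (hrem d hd)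
    _ ≤ ∑ d ∈ s.prodPrimes.divisors, ∑ a ∈ s.prodPrimes.divisors, ∑ b ∈ s.prodPrimes.divisors,
          if d = a.lcm b then |w a| * |w b| else 0 := by
        refine sum_le_sum fun d hd => ?_
        have hsub := Nat.divisors_subset_of_dvd hP (Nat.dvd_of_mem_divisors hd)
        have hnn : ∀ a b, 0 ≤ if d = a.lcm b then |w a| * |w b| else 0 := fun a b => by
          split_ifs <;> positivity
        calc |lambdaSquared w d|
            ≤ ∑ a ∈ d.divisors, ∑ b ∈ d.divisors, if d = a.lcm b then |w a| * |w b| else 0 := by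
              refine (abs_sum_le_sum_abs _ _).trans (sum_le_sum fun a _ => ?_)
              refine (abs_sum_le_sum_abs _ _).trans (sum_le_sum fun b _ => ?_)
              split_ifs <;> simp [abs_mul]
          _ ≤ ∑ a ∈ d.divisors, ∑ b ∈ s.prodPrimes.divisors,
                if d = a.lcm b then |w a| * |w b| else 0 :=
              sum_le_sum fun a _ => sum_le_sum_of_subset_of_nonneg hsub fun b _ _ => hnn a b
          _ ≤ _ := sum_le_sum_of_subset_of_nonneg hsub fun a _ _ => sum_nonneg fun b _ => hnn a b
    _ = ∑ a ∈ s.prodPrimes.divisors, ∑ b ∈ s.prodPrimes.divisors, |w a| * |w b| := by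
        rw [sum_comm]
        refine sum_congr rfl fun a ha => ?_
        rw [sum_comm]
        refine sum_congr rfl fun b hb => ?_
        rw [sum_ite_eq' _ (a.lcm b), if_pos]
        exact Nat.mem_divisors.mpr ⟨Nat.lcm_dvd (Nat.dvd_of_mem_divisors ha)
          (Nat.dvd_of_mem_divisors hb), hP⟩
    _ = (∑ d ∈ s.prodPrimes.divisors, |w d|) ^ 2 := by rw [sq, sum_mul_sum]
    _ ≤ (R : ℝ) ^ 2 := by gcongr

/-- The Selberg upper bound sieve, for sequences with remainders bounded by `1`. -/
theorem siftedSum_le_div_selbergSum_add_sq {R : ℕ} (hR : 1 ≤ R)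
    (hrem : ∀ d ∈ s.prodPrimes.divisors, |s.rem d| ≤ 1) :
    s.siftedSum ≤ s.totalMass / s.selbergSum R + (R : ℝ) ^ 2 := by
  have h := siftedSum_le_mainSum_errSum_of_upperMoebius (s := s) _
    (upperMoebius_lambdaSquared _ (selbergWeight_one (s := s) hR))
  rw [mainSum_selbergWeight hR, ← div_eq_mul_inv] at h
  exact h.trans (by gcongr; exact errSum_selbergWeight_le hR hrem)

end BoundingSieve


/-- The arithmetic function `n ↦ 1 / n`. -/
noncomputable def invArith : ArithmeticFunction ℝ := ⟨fun n => (n : ℝ)⁻¹, by simp⟩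

theorem invArith_apply (n : ℕ) : invArith n = (n : ℝ)⁻¹ := rfl

theorem invArith_isMultiplicative : invArith.IsMultiplicative :=
  ⟨by simp [invArith_apply], fun _ => by simp [invArith_apply, mul_comm]⟩

/-- The sieve removing from the interval `(a, a + m]` the multiples of primes up to `R`. -/
noncomputable def intervalSieve (a m R : ℕ) : BoundingSieve where
  support := Ioc a (a + m)
  prodPrimes := primorial R
  prodPrimes_squarefree := squarefree_primorial R
  weights := fun _ => 1
  weights_nonneg := fun _ => zero_le_one
  totalMass := m
  nu := invArith
  nu_mult := invArith_isMultiplicative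
  nu_pos_of_prime := fun p hp _ => by
    rw [invArith_apply]; exact inv_pos.mpr (mod_cast hp.pos)
  nu_lt_one_of_prime := fun p hp _ => by
    rw [invArith_apply]; exact inv_lt_one_of_one_lt₀ (mod_cast hp.one_lt)

theorem abs_rem_intervalSieve_le_one (a m R : ℕ) {d : ℕ} (hd : 0 < d) :
    |(intervalSieve a m R).rem d| ≤ 1 := by
  have hcount : (intervalSieve a m R).multSum d = (((a + m) / d : ℕ) : ℝ) - ((a / d : ℕ) : ℝ) := by
    have hsplit : #{n ∈ Ioc 0 (a + m) | d ∣ n} =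
        #{n ∈ Ioc 0 a | d ∣ n} + #{n ∈ Ioc a (a + m) | d ∣ n} := by
      rw [← card_union_of_disjoint, ← filter_union, Ioc_union_Ioc_eq_Ioc (by omega) (by omega)]
      exact disjoint_filter_filter (Ioc_disjoint_Ioc_of_le le_rfl)
    rw [Nat.Ioc_filter_dvd_card_eq_div, Nat.Ioc_filter_dvd_card_eq_div] at hsplit
    simp only [BoundingSieve.multSum, intervalSieve, sum_boole]
    rw [hsplit]; push_cast; ring
  have hd' : (0 : ℝ) < d := mod_cast hd
  rw [BoundingSieve.rem, hcount]
  simp only [intervalSieve, invArith_apply]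
  have h1 : (((a + m) / d : ℕ) : ℝ) ≤ (a + m) / d := by simpa using Nat.cast_div_le (α := ℝ) (m := a + m) (n := d)
  have h2 : ((a / d : ℕ) : ℝ) ≤ a / d := Nat.cast_div_le
  have h3 : ((a + m : ℝ)) / d < ((a + m) / d : ℕ) + 1 := by
    rw [div_lt_iff₀ hd']
    rw [mul_comm]; exact_mod_cast Nat.lt_mul_div_succ (a + m) hd
  have h4 : (a : ℝ) / d < (a / d : ℕ) + 1 := by
    rw [div_lt_iff₀ hd']
    rw [mul_comm]; exact_mod_cast Nat.lt_mul_div_succ a hd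
  rw [add_div] at h1 h3
  have h5 : (d : ℝ)⁻¹ * m = m / d := by ring
  rw [h5, abs_le]
  constructor <;> linarith

/-- The factors `(1 - 1 / p)⁻¹` dominate the sum of `1 / m` over `m` composed of the same primes. -/
theorem sum_inv_le_prod_primeFactors (l : ℕ) (T : Finset ℕ)
    (hT : ∀ m ∈ T, m ∈ Nat.factoredNumbers l.primeFactors) :
    ∑ m ∈ T, (m : ℝ)⁻¹ ≤ ∏ p ∈ l.primeFactors, (1 - (p : ℝ)⁻¹)⁻¹ := by
  let f : ℕ →* ℝ := (invMonoidWithZeroHom.comp (Nat.castRingHom ℝ).toMonoidWithZeroHom : ℕ →*₀ ℝ)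
  have hf : ∀ n : ℕ, f n = (n : ℝ)⁻¹ := fun n => rfl
  have h := (EulerProduct.summable_and_hasSum_factoredNumbers_prod_filter_prime_geometric (f := f)
    (fun {p} hp => by
      rw [hf, norm_inv, RCLike.norm_natCast]
      exact inv_lt_one_of_one_lt₀ (mod_cast hp.one_lt)) l.primeFactors).2
  have hfilter : l.primeFactors.filter Nat.Prime = l.primeFactors :=
    filter_true_of_mem fun p hp => Nat.prime_of_mem_primeFactors hp
  rw [hfilter] at h
  simp only [hf] at h
  have := sum_le_hasSum (T.subtype (· ∈ Nat.factoredNumbers l.primeFactors))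
    (fun m _ => by positivity) h
  rwa [sum_subtype_of_mem (fun m : ℕ => (m : ℝ)⁻¹) hT] at this

theorem log_le_selbergSum_intervalSieve (a m R : ℕ) :
    Real.log (R + 1 : ℕ) ≤ (intervalSieve a m R).selbergSum R := by
  classical
  refine (log_add_one_le_harmonic R).trans ?_
  rw [harmonic_eq_sum_Icc]
  push_cast
  let rad : ℕ → ℕ := fun n => ∏ p ∈ n.primeFactors, p
  have hmaps : ∀ n ∈ Icc 1 R, rad n ∈ (primorial R).divisors.filter (· ≤ R) := by
    intro n hn
    rw [mem_Icc] at hn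
    have hle : rad n ≤ R := (Nat.le_of_dvd hn.1 (Nat.prod_primeFactors_dvd n)).trans hn.2
    have hsq : Squarefree (rad n) := by
      have : rad n ∣ primorial n := by
        rw [primorial]
        refine prod_dvd_prod_of_subset _ _ _ fun p hp => ?_
        have hp' := Nat.prime_of_mem_primeFactors hp
        have hpn := Nat.le_of_mem_primeFactors hp
        simp [hp', hpn]
      exact (squarefree_primorial n).squarefree_of_dvd this
    rw [mem_filter, Nat.mem_divisors]
    exact ⟨⟨hsq.dvd_primorial.trans (primorial_dvd_primorial hle), primorial_ne_zero R⟩, hle⟩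
  rw [← sum_fiberwise_of_maps_to hmaps, BoundingSieve.selbergSum]
  refine sum_le_sum fun l hl => ?_
  have hl0 : 0 < l := Nat.pos_of_mem_divisors (mem_filter.mp hl).1
  rw [BoundingSieve.selbergTerms_apply]
  simp only [intervalSieve, invArith_apply]
  have hrad : ∀ n ∈ (Icc 1 R).filter (rad · = l), l ∣ n ∧ n.primeFactors = l.primeFactors ∧ n ≠ 0 := by
    intro n hn
    simp only [mem_filter, mem_Icc] at hn
    obtain ⟨hn1, rfl⟩ := hn
    refine ⟨Nat.prod_primeFactors_dvd n, ?_, by omega⟩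
    exact (Nat.primeFactors_prod fun p hp => Nat.prime_of_mem_primeFactors hp).symm
  have hinj : Set.InjOn (· / l) (((Icc 1 R).filter (rad · = l) : Finset ℕ) : Set ℕ) := by
    intro x hx y hy hxy
    have hxy : x / l = y / l := hxy
    rw [← Nat.div_mul_cancel (hrad x hx).1, ← Nat.div_mul_cancel (hrad y hy).1, hxy]
  have hT := sum_inv_le_prod_primeFactors l (((Icc 1 R).filter (rad · = l)).image (· / l)) (by
    intro k hk
    obtain ⟨n, hn, rfl⟩ := mem_image.mp hk
    obtain ⟨h1, h2, h3⟩ := hrad n hn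
    refine Nat.mem_factoredNumbers_of_primeFactors_subset
      (Nat.div_pos (Nat.le_of_dvd (Nat.pos_of_ne_zero h3) h1) hl0).ne' ?_
    rw [← h2]
    exact Nat.primeFactors_mono (Nat.div_dvd_of_dvd h1) h3)
  rw [sum_image hinj] at hT
  refine le_trans (le_of_eq ?_) (mul_le_mul_of_nonneg_left hT (by positivity : (0 : ℝ) ≤ (l : ℝ)⁻¹))
  rw [mul_sum]
  refine sum_congr rfl fun n hn => ?_
  have hl' : (l : ℝ) ≠ 0 := by positivity
  rw [Nat.cast_div (hrad n hn).1 hl', inv_div]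
  field_simp

/-- A Brun–Titchmarsh type bound for primes larger than the sifting level. -/
theorem card_primes_Ioc_le (a m : ℕ) {R : ℕ} (hR : 1 ≤ R) (haR : R ≤ a) :
    (#{n ∈ Ioc a (a + m) | n.Prime} : ℝ) ≤ m / Real.log (R + 1 : ℕ) + (R : ℝ) ^ 2 := by
  have hlog : 0 < Real.log (R + 1 : ℕ) := Real.log_pos (by push_cast; norm_cast; omega)
  have h := BoundingSieve.siftedSum_le_div_selbergSum_add_sq (s := intervalSieve a m R) hR
    fun d hd => abs_rem_intervalSieve_le_one a m R (Nat.pos_of_mem_divisors hd)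
  calc (#{n ∈ Ioc a (a + m) | n.Prime} : ℝ) ≤ (intervalSieve a m R).siftedSum := by
        rw [BoundingSieve.siftedSum, ← sum_filter]
        simp only [intervalSieve, sum_const, nsmul_eq_mul, mul_one]
        refine Nat.cast_le.mpr (card_le_card fun n hn => ?_)
        simp only [mem_filter, mem_Ioc] at hn
        refine mem_filter.mpr ⟨mem_Ioc.mpr hn.1, Nat.Coprime.symm ((Nat.Prime.coprime_iff_not_dvd hn.2).mpr ?_)⟩
        rw [hn.2.dvd_primorial_iff]; omega
    _ ≤ _ := h
    _ ≤ _ := by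
        have := log_le_selbergSum_intervalSieve a m R
        have hm : (intervalSieve a m R).totalMass = m := rfl
        rw [hm]
        gcongr

/-- The level `R = ⌊m ^ (1 / 3)⌋` in the Selberg sieve bound for primes in short intervals. -/
theorem card_primes_Ioc_le_rpow (a : ℕ) {m : ℕ} (hm : 2 ≤ m) (ham : m ≤ 2 * a) :
    (#{n ∈ Ioc a (a + m) | n.Prime} : ℝ) ≤ 3 * m / Real.log m + (m : ℝ) ^ (2 / 3 : ℝ) := by
  have hm1 : (1 : ℝ) < m := by exact_mod_cast hm
  set z : ℝ := (m : ℝ) ^ (1 / 3 : ℝ) with hz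
  have hz1 : 1 ≤ z := Real.one_le_rpow hm1.le (by norm_num)
  have hz0 : 0 ≤ z := by linarith
  have hz3 : z ^ 3 = m := by
    rw [hz, ← Real.rpow_natCast, ← Real.rpow_mul (by positivity)]; norm_num
  have hz2 : z ^ 2 = (m : ℝ) ^ (2 / 3 : ℝ) := by
    rw [hz, ← Real.rpow_natCast, ← Real.rpow_mul (by positivity)]; norm_num
  have hR : 1 ≤ ⌊z⌋₊ := (Nat.one_le_floor_iff z).mpr hz1
  have hRz : (⌊z⌋₊ : ℝ) ≤ z := Nat.floor_le hz0
  have hRa : ⌊z⌋₊ ≤ a := by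
    by_contra! hlt
    have h1 : ((a : ℝ) + 1) ≤ z := le_trans (by exact_mod_cast hlt) hRz
    have h2 : ((a : ℝ) + 1) ^ 3 ≤ m := hz3 ▸ pow_le_pow_left₀ (by positivity) h1 3
    have h3 : (m : ℝ) ≤ 2 * a := by exact_mod_cast ham
    have h4 : (0 : ℝ) ≤ a := by positivity
    nlinarith [pow_nonneg h4 3, pow_nonneg h4 2]
  have hlogm : 0 < Real.log m := Real.log_pos hm1
  have hlog : Real.log m / 3 ≤ Real.log (⌊z⌋₊ + 1 : ℕ) := by
    have : Real.log m / 3 = Real.log z := by rw [hz, Real.log_rpow (by linarith)]; ring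
    rw [this]
    refine Real.log_le_log (by linarith) ?_
    push_cast
    exact (Nat.lt_floor_add_one z).le
  refine (card_primes_Ioc_le a m hR hRa).trans ?_
  rw [← hz2]
  have : (m : ℝ) / Real.log (⌊z⌋₊ + 1 : ℕ) ≤ 3 * m / Real.log m := by
    rw [show 3 * (m : ℝ) / Real.log m = m / (Real.log m / 3) by field_simp]
    gcongr
  gcongr


theorem sum_div_eq_partial_sums (a : ℕ → ℝ) (M : ℕ) :
    ∑ j ∈ Icc 1 M, a j / j = (∑ j ∈ Icc 1 M, a j) / (M + 1) +
      ∑ j ∈ Icc 1 M, (∑ i ∈ Icc 1 j, a i) / (j * (j + 1)) := by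
  induction M with
  | zero => simp
  | succ M ih =>
    have h : 1 ≤ M + 1 := by omega
    rw [sum_Icc_succ_top h, ih, sum_Icc_succ_top h (fun j : ℕ => (∑ i ∈ Icc 1 j, a i) / (j * (j + 1))),
      sum_Icc_succ_top h]
    push_cast
    field_simp
    ring

theorem one_div_le_log_succ_sub_log {t : ℝ} (ht : 0 < t) :
    1 / (t + 1) ≤ Real.log (t + 1) - Real.log t := by
  have h := Real.one_sub_inv_le_log_of_pos (x := (t + 1) / t) (by positivity)
  rw [Real.log_div (by positivity) ht.ne', inv_div] at h
  calc 1 / (t + 1) = 1 - t / (t + 1) := by field_simp; ring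
    _ ≤ _ := h

theorem log_log_succ_sub_ge {t : ℝ} (ht : 1 < t) :
    1 / ((t + 1) * Real.log (t + 1)) ≤ Real.log (Real.log (t + 1)) - Real.log (Real.log t) := by
  have h0 : 0 < Real.log t := Real.log_pos ht
  have h1 : 0 < Real.log (t + 1) := Real.log_pos (by linarith)
  have h := Real.one_sub_inv_le_log_of_pos (x := Real.log (t + 1) / Real.log t) (by positivity)
  rw [Real.log_div h1.ne' h0.ne', inv_div] at h
  refine le_trans ?_ h
  have h2 := one_div_le_log_succ_sub_log (t := t) (by linarith)
  calc 1 / ((t + 1) * Real.log (t + 1)) = (1 / (t + 1)) / Real.log (t + 1) := by field_simp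
    _ ≤ (Real.log (t + 1) - Real.log t) / Real.log (t + 1) := by gcongr
    _ = _ := by field_simp

theorem rpow_neg_third_sub_succ_ge {t : ℝ} (ht : 0 < t) :
    (t + 1) ^ (-(1 / 3) : ℝ) / (t + 1) ≤
      3 * (t ^ (-(1 / 3) : ℝ) - (t + 1) ^ (-(1 / 3) : ℝ)) := by
  rw [Real.rpow_neg ht.le, Real.rpow_neg (by linarith)]
  set u := t ^ (1 / 3 : ℝ) with hu
  set v := (t + 1) ^ (1 / 3 : ℝ) with hv
  have hu0 : 0 < u := Real.rpow_pos_of_pos ht _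
  have hv0 : 0 < v := Real.rpow_pos_of_pos (by linarith) _
  have hu3 : u ^ 3 = t := by
    rw [hu, ← Real.rpow_natCast, ← Real.rpow_mul ht.le]; norm_num
  have hv3 : v ^ 3 = t + 1 := by
    rw [hv, ← Real.rpow_natCast, ← Real.rpow_mul (by linarith)]; norm_num
  have huv : u ≤ v := Real.rpow_le_rpow ht.le (by linarith) (by norm_num)
  rw [← hv3]
  have h1 : 1 = (v - u) * (v ^ 2 + v * u + u ^ 2) := by linear_combination hu3 - hv3
  have h2 : 1 ≤ (v - u) * (3 * v ^ 2) := by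
    calc (1 : ℝ) = (v - u) * (v ^ 2 + v * u + u ^ 2) := h1
      _ ≤ (v - u) * (3 * v ^ 2) := by
        refine mul_le_mul_of_nonneg_left ?_ (by linarith)
        nlinarith
  have h3 : u⁻¹ - v⁻¹ = (v - u) / (u * v) := by field_simp
  have h4 : v⁻¹ / v ^ 3 = 1 / v ^ 4 := by field_simp
  rw [h3, h4, ← mul_div_assoc, div_le_div_iff₀ (by positivity) (by positivity)]
  nlinarith [mul_le_mul_of_nonneg_right h2 (by positivity : 0 ≤ v ^ 2),
    mul_le_mul_of_nonneg_right huv hv0.le]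

/-- Partial summation of the trivial bound (up to `27`) and the sieve bound (from `28` on). -/
theorem sum_partial_sums_le {A : ℕ → ℝ} {M : ℕ} (hM : 27 ≤ M) (h1 : ∀ j, A j ≤ j)
    (h2 : ∀ j, 28 ≤ j → j ≤ M → A j ≤ 3 * j / Real.log j + (j : ℝ) ^ (2 / 3 : ℝ)) :
    ∑ j ∈ Icc 1 M, A j / (j * (j + 1)) ≤
      Real.log 28 - 3 * Real.log (Real.log 27) + 1 + 3 * Real.log (Real.log M) := by
  have hsmall : ∀ N : ℕ, ∑ j ∈ Icc 1 N, A j / (j * (j + 1)) ≤ Real.log (N + 1) := by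
    intro N
    induction N with
    | zero => simp
    | succ N ih =>
      rw [sum_Icc_succ_top (by omega)]
      have h := one_div_le_log_succ_sub_log (t := N + 1) (by positivity)
      have h' : A (N + 1) / ((N + 1 : ℕ) * ((N + 1 : ℕ) + 1)) ≤ 1 / ((N : ℝ) + 1 + 1) := by
        push_cast
        rw [div_le_div_iff₀ (by positivity) (by positivity)]
        have := h1 (N + 1)
        push_cast at this
        nlinarith [(by positivity : (0 : ℝ) ≤ N)]
      push_cast at h' ⊢
      linarith
  have hmain : ∀ N : ℕ, 27 ≤ N → N ≤ M → ∑ j ∈ Icc 1 N, A j / (j * (j + 1)) ≤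
      Real.log 28 - 3 * Real.log (Real.log 27) + 1 + 3 * Real.log (Real.log N) -
        3 * (N : ℝ) ^ (-(1 / 3) : ℝ) := by
    intro N hN
    induction N, hN using Nat.le_induction with
    | base =>
      intro _
      have h := hsmall 27
      have h27 : (27 : ℝ) ^ (-(1 / 3) : ℝ) = 1 / 3 := by
        rw [show (27 : ℝ) = 3 ^ (3 : ℝ) by norm_num, ← Real.rpow_mul (by norm_num)]
        norm_num [Real.rpow_neg_one]
      push_cast at h ⊢
      rw [h27]
      norm_num at h ⊢
      linarith
    | succ N hN ih =>
      intro hNM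
      have ih := ih (by omega)
      rw [sum_Icc_succ_top (by omega)]
      have hN' : (27 : ℝ) ≤ N := by exact_mod_cast hN
      have ha := log_log_succ_sub_ge (t := N) (by linarith)
      have hb := rpow_neg_third_sub_succ_ge (t := N) (by linarith)
      have hc := h2 (N + 1) (by omega) hNM
      have hlog : 0 < Real.log ((N : ℝ) + 1) := Real.log_pos (by linarith)
      push_cast at hc ⊢
      set t : ℝ := (N : ℝ) + 1 with ht
      have ht0 : 0 < t := by positivity
      have hpow : t ^ (2 / 3 : ℝ) = t * t ^ (-(1 / 3) : ℝ) := by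
        rw [← Real.rpow_one_add' ht0.le (by norm_num)]; norm_num
      have hd : A (N + 1) / (t * (t + 1)) ≤ 3 * (1 / (t * Real.log t)) + t ^ (-(1 / 3) : ℝ) / t := by
        rw [hpow] at hc
        have hr : 0 ≤ t ^ (-(1 / 3) : ℝ) := by positivity
        calc A (N + 1) / (t * (t + 1))
            ≤ (3 * t / Real.log t + t * t ^ (-(1 / 3) : ℝ)) / (t * (t + 1)) := by gcongr
          _ ≤ (3 * t / Real.log t + t * t ^ (-(1 / 3) : ℝ)) / (t * t) := by
              gcongr; linarith
          _ = _ := by field_simp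
      linarith
  have h := hmain M hM le_rfl
  have : (0 : ℝ) ≤ (M : ℝ) ^ (-(1 / 3) : ℝ) := by positivity
  linarith

theorem log_twenty_eight_le : Real.log 28 ≤ 3 * Real.log (Real.log 27) := by
  have h3 : (1.09 : ℝ) ≤ Real.log 3 := by
    rw [Real.le_log_iff_exp_le (by norm_num)]
    have h1 : Real.exp 1.09 = Real.exp 1 * Real.exp 0.09 := by rw [← Real.exp_add]; norm_num
    have h2 : Real.exp 0.09 ≤ 1 / (1 - 0.09) := Real.exp_bound_div_one_sub_of_interval (by norm_num) (by norm_num)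
    rw [h1]
    nlinarith [Real.exp_one_lt_d9, Real.exp_pos 1, Real.exp_pos 0.09]
  have h27 : (3.27 : ℝ) ≤ Real.log 27 := by
    rw [show (27 : ℝ) = 3 ^ 3 by norm_num, Real.log_pow]; push_cast; linarith
  calc Real.log 28 ≤ Real.log (Real.log 27 ^ 3) := by
        refine Real.log_le_log (by norm_num) ?_
        calc (28 : ℝ) ≤ 3.27 ^ 3 := by norm_num
          _ ≤ _ := by gcongr
    _ = _ := by rw [Real.log_pow]; norm_num

/-- Primes below `N` weighted by the inverse of their distance to `N`. -/
theorem sum_prime_inv_dist_le {N M : ℕ} (hM : 8000 ≤ M) (hMN : 3 * M + 2 ≤ 2 * N) :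
    ∑ j ∈ Icc 1 M, (if (N - j).Prime then (1 : ℝ) else 0) / j ≤
      3 * Real.log (Real.log M) + 1.425 := by
  set a : ℕ → ℝ := fun j => if (N - j).Prime then (1 : ℝ) else 0 with ha
  have hM' : (8000 : ℝ) ≤ M := by exact_mod_cast hM
  have h1 : ∀ j : ℕ, ∑ i ∈ Icc 1 j, a i ≤ j := by
    intro j
    calc ∑ i ∈ Icc 1 j, a i ≤ ∑ i ∈ Icc 1 j, (1 : ℝ) :=
          sum_le_sum fun i _ => by simp only [ha]; split_ifs <;> norm_num
      _ = j := by simp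
  have h2 : ∀ j : ℕ, 28 ≤ j → j ≤ M →
      ∑ i ∈ Icc 1 j, a i ≤ 3 * j / Real.log j + (j : ℝ) ^ (2 / 3 : ℝ) := by
    intro j hj hjM
    refine le_trans ?_ (card_primes_Ioc_le_rpow (N - j - 1) (m := j) (by omega) (by omega))
    simp only [ha, sum_boole]
    refine Nat.cast_le.mpr (card_le_card_of_injOn (fun i => N - i) ?_ ?_)
    · intro i hi
      simp only [coe_filter, Set.mem_ofPred_eq, mem_Icc, mem_Ioc] at hi ⊢
      exact ⟨by omega, hi.2⟩
    · intro i hi k hk hik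
      simp only [coe_filter, Set.mem_ofPred_eq, mem_Icc] at hi hk hik
      omega
  have hsum := sum_partial_sums_le (A := fun j => ∑ i ∈ Icc 1 j, a i) (by omega : 27 ≤ M) h1 h2
  have hlast := h2 M (by omega) le_rfl
  have hlog8 : 8 ≤ Real.log M := by
    rw [Real.le_log_iff_exp_le (by linarith)]
    refine le_trans ?_ hM'
    have : Real.exp 8 = Real.exp 1 ^ 8 := by rw [← Real.exp_nat_mul]; norm_num
    rw [this]
    calc Real.exp 1 ^ 8 ≤ 3 ^ 8 := by gcongr; linarith [Real.exp_one_lt_d9]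
      _ ≤ 8000 := by norm_num
  have hpow : (M : ℝ) ^ (2 / 3 : ℝ) ≤ M / 20 := by
    have h20 : (20 : ℝ) ≤ (M : ℝ) ^ (1 / 3 : ℝ) := by
      calc (20 : ℝ) = (8000 : ℝ) ^ (1 / 3 : ℝ) := by
            rw [show (8000 : ℝ) = 20 ^ (3 : ℝ) by norm_num, ← Real.rpow_mul (by norm_num)]; norm_num
        _ ≤ _ := by gcongr
    have hmul : (M : ℝ) = (M : ℝ) ^ (2 / 3 : ℝ) * (M : ℝ) ^ (1 / 3 : ℝ) := by
      rw [← Real.rpow_add (by linarith)]; norm_num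
    have : 0 ≤ (M : ℝ) ^ (2 / 3 : ℝ) := by positivity
    nlinarith
  have hend : (∑ i ∈ Icc 1 M, a i) / (M + 1) ≤ 0.425 := by
    rw [div_le_iff₀ (by positivity)]
    have : 3 * (M : ℝ) / Real.log M ≤ 3 * M / 8 := by gcongr
    linarith
  rw [sum_div_eq_partial_sums a M]
  have := log_twenty_eight_le
  linarith


theorem sum_inv_sq_Icc_le_two (n : ℕ) : ∑ j ∈ Icc 1 n, ((j : ℝ) ^ 2)⁻¹ ≤ 2 := by
  have h := sum_Ioo_inv_sq_le (α := ℝ) 0 (n + 1)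
  have he : Ioo 0 (n + 1) = Icc 1 n := by ext; simp [Nat.one_le_iff_ne_zero, Nat.pos_iff_ne_zero]
  rw [he] at h
  norm_num at h ⊢
  exact h

theorem sum_inv_sq_Icc_two_le_one (n : ℕ) : ∑ j ∈ Icc 2 n, ((j : ℝ) ^ 2)⁻¹ ≤ 1 := by
  have h := sum_Ioo_inv_sq_le (α := ℝ) 1 (n + 1)
  have he : Ioo 1 (n + 1) = Icc 2 n := by ext; simp; omega
  rw [he] at h
  norm_num at h ⊢
  exact h

/-- Distinct `k`-th powers with `2 ≤ k` are far apart. -/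
theorem four_mul_pow_le_sq_sub_pow {a b k : ℕ} (hk : 2 ≤ k) (hab : b < a) :
    4 * (b : ℝ) ^ k ≤ ((a : ℝ) ^ k - (b : ℝ) ^ k) ^ 2 := by
  have h1 : (b : ℝ) ^ k + 2 * (b : ℝ) ^ (k - 1) ≤ (a : ℝ) ^ k := by
    have hab' : (b : ℝ) + 1 ≤ a := by exact_mod_cast hab
    have hk' : (2 : ℝ) ≤ k := by exact_mod_cast hk
    obtain ⟨m, rfl⟩ : ∃ m, k = m + 2 := ⟨k - 2, by omega⟩
    calc (b : ℝ) ^ (m + 2) + 2 * (b : ℝ) ^ (m + 1) ≤ (b : ℝ) ^ m * (b + 1) ^ 2 := by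
          have : 0 ≤ (b : ℝ) ^ m := by positivity
          rw [pow_succ (b : ℝ) (m + 1), pow_succ]; nlinarith
      _ ≤ (a : ℝ) ^ m * a ^ 2 := by gcongr
      _ = _ := by ring
  have h2 : (b : ℝ) ^ k ≤ ((b : ℝ) ^ (k - 1)) ^ 2 := by
    rw [← pow_mul]
    exact_mod_cast (show b ^ k ≤ b ^ ((k - 1) * 2) by
      rcases Nat.eq_zero_or_pos b with rfl | hb
      · simp [show k ≠ 0 by omega]
      · exact Nat.pow_le_pow_right hb (by omega))
  have h3 : 0 ≤ (b : ℝ) ^ (k - 1) := by positivity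
  nlinarith

theorem psi_sub_theta_le_mul_sqrt_of_large {x : ℝ} (hx : 4096 ≤ x) :
    Chebyshev.psi x - Chebyshev.theta x ≤ 8.1 * √x := by
  have hx0 : 0 < x := by linarith
  set t := x ^ (1 / 6 : ℝ) with ht
  have ht4 : 4 ≤ t := by
    calc (4 : ℝ) = (4096 : ℝ) ^ (1 / 6 : ℝ) := by
          rw [show (4096 : ℝ) = 4 ^ (6 : ℝ) by norm_num, ← Real.rpow_mul (by norm_num)]; norm_num
      _ ≤ _ := by rw [ht]; gcongr
  have h2 : x ^ (2 : ℝ)⁻¹ = t ^ 3 := by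
    rw [ht, ← Real.rpow_natCast, ← Real.rpow_mul hx0.le]; norm_num
  have h3 : x ^ (3 : ℝ)⁻¹ = t ^ 2 := by
    rw [ht, ← Real.rpow_natCast, ← Real.rpow_mul hx0.le]; norm_num
  have h5 : x ^ (5 : ℝ)⁻¹ ≤ t ^ 2 := by
    rw [← h3]; exact Real.rpow_le_rpow_of_exponent_le (by linarith) (by norm_num)
  have hs : √x = t ^ 3 := by rw [Real.sqrt_eq_rpow, ← h2]; norm_num
  have hψ := Chebyshev.psi_sub_theta_le_psi_add_psi_add_psi x
  have e2 := Chebyshev.psi_le_const_mul_self (x := x ^ (2 : ℝ)⁻¹) (by positivity)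
  have e3 := Chebyshev.psi_le_const_mul_self (x := x ^ (3 : ℝ)⁻¹) (by positivity)
  have e5 := Chebyshev.psi_le_const_mul_self (x := x ^ (5 : ℝ)⁻¹) (by positivity)
  have hlog4 : Real.log 4 ≤ 1.3864 := by
    rw [show (4 : ℝ) = 2 ^ 2 by norm_num, Real.log_pow]
    push_cast; linarith [Real.log_two_lt_d9]
  have hlog4' : 0 ≤ Real.log 4 := Real.log_nonneg (by norm_num)
  rw [hs]
  have hcube : t ^ 2 ≤ t ^ 3 / 4 := by nlinarith [sq_nonneg t]
  have : Chebyshev.psi x - Chebyshev.theta x ≤ (Real.log 4 + 4) * (1.5 * t ^ 3) := by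
    rw [h2] at e2 hψ
    rw [h3] at e3 hψ
    have : (Real.log 4 + 4) * x ^ (5 : ℝ)⁻¹ ≤ (Real.log 4 + 4) * t ^ 2 := by gcongr
    nlinarith
  refine this.trans ?_
  have : 0 ≤ t ^ 3 := by positivity
  nlinarith

/-- The integers `n` with `x / 2 < n ≤ x - 1.5`. -/
noncomputable def belowRange (x : ℝ) : Finset ℕ :=
  (Finset.Icc 1 ⌊x⌋₊).filter (fun n : ℕ => x / 2 < (n : ℝ) ∧ (n : ℝ) ≤ x - 1.5)

theorem mem_belowRange {x : ℝ} {n : ℕ} (hn : n ∈ belowRange x) :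
    1 ≤ n ∧ x / 2 < n ∧ (n : ℝ) ≤ x - 1.5 ∧ n + 1 ≤ ⌊x⌋₊ ∧ ⌊x⌋₊ - n ≤ ⌊x / 2⌋₊ ∧
      ((⌊x⌋₊ - n : ℕ) : ℝ) ≤ x - n := by
  simp only [belowRange, mem_filter, mem_Icc] at hn
  obtain ⟨⟨h1, h2⟩, h3, h4⟩ := hn
  have hx : 0 ≤ x := by linarith [(Nat.cast_nonneg n : (0 : ℝ) ≤ n)]
  have h5 : n + 1 ≤ ⌊x⌋₊ := Nat.le_floor (by push_cast; linarith)
  have h6 : ((⌊x⌋₊ - n : ℕ) : ℝ) ≤ x - n := by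
    rw [Nat.cast_sub h2]; linarith [Nat.floor_le hx]
  exact ⟨h1, h3, h4, h5, Nat.le_floor (by linarith), h6⟩

theorem sum_belowRange_dist_le (x : ℝ) {T : Finset ℕ} (hT : T ⊆ belowRange x) {f : ℕ → ℝ}
    (hf : ∀ j, 0 ≤ f j) : ∑ n ∈ T, f (⌊x⌋₊ - n) ≤ ∑ j ∈ Icc 1 ⌊x / 2⌋₊, f j := by
  have hinj : Set.InjOn (fun n => ⌊x⌋₊ - n) (T : Set ℕ) := by
    intro m hm n hn h
    have h1 := (mem_belowRange (hT hm)).2.2.2.1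
    have h2 := (mem_belowRange (hT hn)).2.2.2.1
    have h3 : ⌊x⌋₊ - m = ⌊x⌋₊ - n := h
    omega
  rw [← sum_image (f := f) hinj]
  refine sum_le_sum_of_subset_of_nonneg ?_ fun j _ _ => hf j
  intro j hj
  obtain ⟨n, hn, rfl⟩ := mem_image.mp hj
  have h := mem_belowRange (hT hn)
  exact mem_Icc.mpr ⟨by omega, h.2.2.2.2.1⟩

theorem vonMangoldt_term_le {x : ℝ} {n : ℕ} (hn : n ∈ belowRange x) :
    Λ n / (x / (n : ℝ) - 1) ≤ x * (Λ n / (x - n)) := by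
  obtain ⟨h1, h2, h3, -⟩ := mem_belowRange hn
  have hn0 : (0 : ℝ) < n := by exact_mod_cast h1
  have hd : 0 < x - n := by linarith
  have : Λ n / (x / (n : ℝ) - 1) = n * (Λ n / (x - n)) := by
    rw [div_sub_one hn0.ne', div_div_eq_mul_div]; ring
  rw [this]
  exact mul_le_mul_of_nonneg_right (by linarith) (div_nonneg vonMangoldt_nonneg hd.le)

theorem vonMangoldt_div_le {x : ℝ} {n : ℕ} (hn : n ∈ belowRange x) :
    Λ n / (x - n) ≤ Real.log x * (1 / ((⌊x⌋₊ - n : ℕ) : ℝ)) := by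
  obtain ⟨h1, h2, h3, h4, h5, h6⟩ := mem_belowRange hn
  have hn1 : (1 : ℝ) ≤ n := by exact_mod_cast h1
  have hj : (0 : ℝ) < ((⌊x⌋₊ - n : ℕ) : ℝ) := by exact_mod_cast (by omega : 0 < ⌊x⌋₊ - n)
  have hL : Λ n ≤ Real.log x := vonMangoldt_le_log.trans (Real.log_le_log (by linarith) (by linarith))
  have hL0 : 0 ≤ Real.log x := Real.log_nonneg (by linarith)
  rw [mul_one_div]
  gcongr

theorem sum_vonMangoldt_div_le_trivial {x : ℝ} (hx : 3 ≤ x) :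
    ∑ n ∈ belowRange x, Λ n / (x - n) ≤ Real.log x * (Real.log x + 0.31) := by
  have hL0 : 0 ≤ Real.log x := Real.log_nonneg (by linarith)
  calc ∑ n ∈ belowRange x, Λ n / (x - n)
      ≤ ∑ n ∈ belowRange x, Real.log x * (1 / ((⌊x⌋₊ - n : ℕ) : ℝ)) :=
        sum_le_sum fun n hn => vonMangoldt_div_le hn
    _ ≤ Real.log x * ∑ j ∈ Icc 1 ⌊x / 2⌋₊, 1 / (j : ℝ) := by
        rw [← mul_sum]
        gcongr
        exact sum_belowRange_dist_le x subset_rfl (f := fun j => 1 / (j : ℝ)) fun j => by positivity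
    _ ≤ Real.log x * (Real.log x + 0.31) := by
        gcongr
        have h := harmonic_le_one_add_log ⌊x / 2⌋₊
        rw [harmonic_eq_sum_Icc] at h
        push_cast at h
        simp only [one_div]
        have hfl : 1 ≤ ⌊x / 2⌋₊ := Nat.le_floor (by push_cast; linarith)
        have h' : Real.log (⌊x / 2⌋₊ : ℝ) ≤ Real.log (x / 2) :=
          Real.log_le_log (by exact_mod_cast hfl) (Nat.floor_le (by linarith))
        rw [Real.log_div (by linarith) (by norm_num)] at h'
        linarith [Real.log_two_gt_d9]

theorem sum_primes_vonMangoldt_div_le {x : ℝ} (hx : 20000 ≤ x) :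
    ∑ n ∈ belowRange x with Nat.Prime n, Λ n / (x - n) ≤
      Real.log x * (3 * Real.log (Real.log x) + 1.425) := by
  have hL0 : 0 ≤ Real.log x := Real.log_nonneg (by linarith)
  set M := ⌊x / 2⌋₊ with hMdef
  have hM : 8000 ≤ M := Nat.le_floor (by push_cast; linarith)
  have hM' : (8000 : ℝ) ≤ M := by exact_mod_cast hM
  have hMx : (M : ℝ) ≤ x / 2 := Nat.floor_le (by linarith)
  have hMN : 3 * M + 2 ≤ 2 * ⌊x⌋₊ := by
    have h1 := Nat.lt_floor_add_one x
    have : (3 : ℝ) * M + 2 ≤ 2 * ⌊x⌋₊ := by linarith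
    exact_mod_cast this
  calc ∑ n ∈ belowRange x with Nat.Prime n, Λ n / (x - n)
      ≤ ∑ n ∈ belowRange x with Nat.Prime n, Real.log x *
          ((if (⌊x⌋₊ - (⌊x⌋₊ - n)).Prime then (1 : ℝ) else 0) / ((⌊x⌋₊ - n : ℕ) : ℝ)) := by
        refine sum_le_sum fun n hn => ?_
        rw [mem_filter] at hn
        have h := (mem_belowRange hn.1).2.2.2.1
        rw [Nat.sub_sub_self (by omega), if_pos hn.2]
        exact vonMangoldt_div_le hn.1
    _ ≤ Real.log x * ∑ j ∈ Icc 1 M, (if (⌊x⌋₊ - j).Prime then (1 : ℝ) else 0) / j := by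
        rw [← mul_sum]
        gcongr
        exact sum_belowRange_dist_le x (filter_subset _ _)
          (f := fun j => (if (⌊x⌋₊ - j).Prime then (1 : ℝ) else 0) / (j : ℝ))
          fun j => by split_ifs <;> positivity
    _ ≤ Real.log x * (3 * Real.log (Real.log x) + 1.425) := by
        gcongr
        refine (sum_prime_inv_dist_le hM hMN).trans ?_
        have h1 : Real.log M ≤ Real.log x := Real.log_le_log (by linarith) (by linarith)
        have h2 : Real.log (Real.log M) ≤ Real.log (Real.log x) :=
          Real.log_le_log (Real.log_pos (by linarith)) h1
        linarith

theorem sum_far_prime_powers_le {x : ℝ} (hx : 4096 ≤ x) :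
    ∑ n ∈ belowRange x with ¬Nat.Prime n ∧ √x < x - n, Λ n / (x - n) ≤ 8.1 := by
  have hs : 0 < √x := Real.sqrt_pos.mpr (by linarith)
  calc ∑ n ∈ belowRange x with ¬Nat.Prime n ∧ √x < x - n, Λ n / (x - n)
      ≤ ∑ n ∈ belowRange x with ¬Nat.Prime n ∧ √x < x - n, Λ n / √x := by
        refine sum_le_sum fun n hn => ?_
        have := (mem_filter.mp hn).2.2
        exact div_le_div_of_nonneg_left vonMangoldt_nonneg hs this.le
    _ ≤ (∑ n ∈ Ioc 0 ⌊x⌋₊ with ¬Nat.Prime n, Λ n) / √x := by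
        rw [← sum_div]
        refine div_le_div_of_nonneg_right
          (sum_le_sum_of_subset_of_nonneg ?_ fun n _ _ => vonMangoldt_nonneg) hs.le
        intro n hn
        obtain ⟨h, hp, -⟩ := mem_filter.mp hn
        have := mem_belowRange h
        exact mem_filter.mpr ⟨mem_Ioc.mpr ⟨by omega, by omega⟩, hp⟩
    _ ≤ 8.1 := by
        rw [← Chebyshev.psi_sub_theta_eq_sum_not_prime, div_le_iff₀ hs]
        exact psi_sub_theta_le_mul_sqrt_of_large hx

theorem sum_near_prime_powers_le {x : ℝ} (hx : 3 ≤ x) :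
    ∑ n ∈ belowRange x with ¬Nat.Prime n ∧ ¬√x < x - n, Λ n / (x - n) ≤ Real.log x * 1.5 := by
  have hL0 : 0 ≤ Real.log x := Real.log_nonneg (by linarith)
  set T := (belowRange x).filter fun n : ℕ => (¬Nat.Prime n ∧ ¬√x < x - n) ∧ IsPrimePow n with hT
  let e : ℕ → ℕ := fun n => n.factorization n.minFac
  have hpow : ∀ n ∈ T, n.minFac ^ e n = n := fun n hn =>
    (mem_filter.mp hn).2.2.minFac_pow_factorization_eq
  have he2 : ∀ n ∈ T, 2 ≤ e n := by
    intro n hn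
    have hp := (mem_filter.mp hn).2
    by_contra! hlt
    have h := hpow n hn
    interval_cases hen : e n
    · rw [pow_zero] at h
      exact hp.2.ne_one h.symm
    · rw [pow_one] at h
      exact hp.1.1 (h ▸ Nat.minFac_prime hp.2.ne_one)
  have hclose : ∀ m ∈ T, ∀ n ∈ T, e m = e n → ¬m.minFac < n.minFac := by
    intro m hm n hn hmn hlt
    have h := four_mul_pow_le_sq_sub_pow (he2 m hm) hlt
    have h1 : (m.minFac : ℝ) ^ e m = m := by exact_mod_cast hpow m hm
    have h2 : (n.minFac : ℝ) ^ e m = n := by rw [hmn]; exact_mod_cast hpow n hn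
    rw [h1, h2] at h
    have hm' := mem_filter.mp hm
    have hn' := mem_filter.mp hn
    have hmb := mem_belowRange hm'.1
    have hnb := mem_belowRange hn'.1
    have hmd : x - m ≤ √x := not_lt.mp hm'.2.1.2
    have hnd : x - n ≤ √x := not_lt.mp hn'.2.1.2
    have habs : ((n : ℝ) - m) ^ 2 ≤ √x ^ 2 := by
      refine sq_le_sq' ?_ ?_ <;> linarith
    rw [Real.sq_sqrt (by linarith)] at habs
    linarith
  have hinj : Set.InjOn e (T : Set ℕ) := by
    intro m hm n hn hmn
    have h : m.minFac = n.minFac :=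
      le_antisymm (not_lt.mp (hclose n hn m hm hmn.symm)) (not_lt.mp (hclose m hm n hn hmn))
    rw [← hpow m hm, ← hpow n hn, h, hmn]
  have hterm : ∀ n ∈ T, Λ n / (x - n) ≤ Real.log x *
      (((e n : ℝ) ^ 2)⁻¹ / 2 + (((⌊x⌋₊ - n : ℕ) : ℝ) ^ 2)⁻¹ / 2) := by
    intro n hn
    obtain ⟨h1, h2, h3, h4, h5, h6⟩ := mem_belowRange (mem_filter.mp hn).1
    have hpp := (mem_filter.mp hn).2.2
    have hn1 : (1 : ℝ) ≤ n := by exact_mod_cast h1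
    have hj : (0 : ℝ) < ((⌊x⌋₊ - n : ℕ) : ℝ) := by exact_mod_cast (by omega : 0 < ⌊x⌋₊ - n)
    have he0 : (0 : ℝ) < e n := by exact_mod_cast (by have := he2 n hn; omega : 0 < e n)
    have hΛ : Λ n ≤ Real.log x * (e n : ℝ)⁻¹ := by
      rw [vonMangoldt_apply, if_pos hpp, ← div_eq_mul_inv, le_div_iff₀ he0, mul_comm,
        ← Real.log_pow]
      rw [← Nat.cast_pow, hpow n hn]
      exact Real.log_le_log (by linarith) (by linarith)
    calc Λ n / (x - n) ≤ Real.log x * (e n : ℝ)⁻¹ / ((⌊x⌋₊ - n : ℕ) : ℝ) := by gcongr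
      _ = Real.log x * ((e n : ℝ)⁻¹ * ((⌊x⌋₊ - n : ℕ) : ℝ)⁻¹) := by ring
      _ ≤ _ := by
        gcongr
        rw [← inv_pow, ← inv_pow]
        linarith [two_mul_le_add_sq (e n : ℝ)⁻¹ ((⌊x⌋₊ - n : ℕ) : ℝ)⁻¹]
  have hsumT : ∑ n ∈ belowRange x with ¬Nat.Prime n ∧ ¬√x < x - n, Λ n / (x - n) =
      ∑ n ∈ T, Λ n / (x - n) := by
    rw [hT, ← filter_filter (fun n : ℕ => ¬Nat.Prime n ∧ ¬√x < x - n) IsPrimePow]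
    refine (sum_filter_of_ne fun n _ hne => ?_).symm
    by_contra hpp
    exact hne (by rw [vonMangoldt_apply, if_neg hpp, zero_div])
  rw [hsumT]
  have hE : ∑ n ∈ T, ((e n : ℝ) ^ 2)⁻¹ ≤ 1 := by
    rw [← sum_image (f := fun k : ℕ => ((k : ℝ) ^ 2)⁻¹) hinj]
    refine le_trans (sum_le_sum_of_subset_of_nonneg ?_ fun k _ _ => by positivity)
      (sum_inv_sq_Icc_two_le_one ((T.image e).sup id))
    intro k hk
    obtain ⟨n, hn, rfl⟩ := mem_image.mp hk
    exact mem_Icc.mpr ⟨he2 n hn, le_sup (f := id) hk⟩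
  have hD : ∑ n ∈ T, (((⌊x⌋₊ - n : ℕ) : ℝ) ^ 2)⁻¹ ≤ 2 :=
    (sum_belowRange_dist_le x (filter_subset _ _) (f := fun j => ((j : ℝ) ^ 2)⁻¹)
      fun j => by positivity).trans (sum_inv_sq_Icc_le_two _)
  refine (sum_le_sum hterm).trans ?_
  rw [← mul_sum, sum_add_distrib, ← sum_div, ← sum_div]
  gcongr
  linarith

theorem sum_vonMangoldt_div_le_of_large {x : ℝ} (hx : 20000 ≤ x) (hL : 10 ≤ Real.log x) :
    ∑ n ∈ belowRange x, Λ n / (x - n) ≤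
      Real.log x * (3 * Real.log (Real.log x) + 3.74) := by
  have h1 := sum_primes_vonMangoldt_div_le hx
  have h2 := sum_far_prime_powers_le (x := x) (by linarith)
  have h3 := sum_near_prime_powers_le (x := x) (by linarith)
  rw [← sum_filter_add_sum_filter_not (belowRange x) Nat.Prime,
    ← sum_filter_add_sum_filter_not ((belowRange x).filter fun n : ℕ => ¬Nat.Prime n)
      (fun n : ℕ => √x < x - n), filter_filter, filter_filter]
  linarith

theorem r3_ge {x : ℝ} (hx : 3 ≤ x) :
    x * (Real.log x * (46 / 15 * Real.log (Real.log x) + 3.92)) ≤ r3 x := by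
  have hL : 0 < Real.log x := Real.log_pos (by linarith)
  have hlog2 := Real.log_two_lt_d9
  have hlog2pos : 0 < Real.log 2 := Real.log_pos (by norm_num)
  have hs : 0 < √x := Real.sqrt_pos.mpr (by linarith)
  have hinv : 1.442 ≤ 1 / Real.log 2 := by
    rw [le_div_iff₀ hlog2pos]; linarith
  have hloglog2 : Real.log (Real.log 2) ≤ -0.306 := by
    linarith [Real.log_le_sub_one_of_pos hlog2pos]
  have hsplit : Real.log (Real.log x / Real.log 2) =
      Real.log (Real.log x) - Real.log (Real.log 2) := Real.log_div hL.ne' hlog2pos.ne'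
  have hpi : 0 ≤ Real.pi ^ 2 / 6 - 1 := by nlinarith [Real.pi_gt_three]
  have hden0 : 0 < 1 + √(x - 1.5) - √x := by
    have h : √x < 1 + √(x - 1.5) := by
      rw [Real.sqrt_lt' (by positivity)]
      have h1 : 0 ≤ x - 1.5 := by linarith
      have h2 : 1 ≤ √(x - 1.5) := Real.one_le_sqrt.mpr (by linarith)
      nlinarith [Real.sq_sqrt h1]
    linarith
  have hden1 : 1 + √(x - 1.5) - √x ≤ 1 := by
    linarith [Real.sqrt_le_sqrt (show x - 1.5 ≤ x by linarith)]
  have hfirst : 2 ≤ 2 / (1 + √(x - 1.5) - √x) := by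
    rw [le_div_iff₀ hden0]; linarith
  have hs2 : 1.7 ≤ √x := Real.le_sqrt_of_sq_le (by norm_num; linarith)
  have hq : -2 ≤ Real.log ((√2 - 1) / (√2 + 1)) := by
    have hr1 : 1.41 < √2 := Real.lt_sqrt_of_sq_lt (by norm_num)
    have hr2 : √2 < 1.42 := by rw [Real.sqrt_lt' (by norm_num)]; norm_num
    rw [Real.le_log_iff_exp_le (by apply div_pos <;> linarith)]
    have he : Real.exp (-2) ≤ 1 / 7 := by
      rw [Real.exp_neg, ← one_div]
      apply one_div_le_one_div_of_le (by norm_num)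
      have : Real.exp 2 = Real.exp 1 * Real.exp 1 := by rw [← Real.exp_add]; norm_num
      rw [this]
      nlinarith [Real.exp_one_gt_d9]
    refine he.trans ?_
    rw [div_le_div_iff₀ (by norm_num) (by linarith)]
    linarith
  have hsecond : (1 / √x) * (1 - Real.log ((√2 - 1) / (√2 + 1))) ≤ 2 := by
    rw [one_div, inv_mul_le_iff₀ hs]; linarith
  have hlast := mul_nonneg hpi (sub_nonneg.mpr (hsecond.trans hfirst))
  have hdiv : 0 ≤ 2 / Real.log x := by positivity
  rw [r3, mul_assoc, hsplit]
  refine mul_le_mul_of_nonneg_left (mul_le_mul_of_nonneg_left ?_ hL.le) (by linarith)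
  linarith

/-- The trivial bound suffices while `log x ≤ 10`. -/
theorem add_le_log_bound {y : ℝ} (h1 : 1 ≤ y) (h2 : y ≤ 10) :
    y + 0.31 ≤ 46 / 15 * Real.log y + 3.92 := by
  have h10 : 2.27 ≤ Real.log 10 := by
    rw [show (10 : ℝ) = 2 ^ 3 * 1.25 by norm_num, Real.log_mul (by norm_num) (by norm_num),
      Real.log_pow]
    have := Real.one_sub_inv_le_log_of_pos (x := 1.25) (by norm_num)
    norm_num at this ⊢
    linarith [Real.log_two_gt_d9]
  have hc := strictConcaveOn_log_Ioi.concaveOn.2 (show (1 : ℝ) ∈ Set.Ioi 0 by simp)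
    (show (10 : ℝ) ∈ Set.Ioi 0 by simp) (show 0 ≤ (10 - y) / 9 by linarith)
    (show 0 ≤ (y - 1) / 9 by linarith) (by ring)
  simp only [smul_eq_mul, Real.log_one, mul_zero, zero_add] at hc
  rw [show (10 - y) / 9 * 1 + (y - 1) / 9 * 10 = y by ring] at hc
  nlinarith

theorem sum_vonMangoldt_below_le_r3 (x : ℝ) (hx : 3 ≤ x) :
    ∑ n ∈ (Finset.Icc 1 ⌊x⌋₊).filter (fun n : ℕ => x / 2 < (n : ℝ) ∧ (n : ℝ) ≤ x - 1.5),
      Λ n / (x / (n : ℝ) - 1) ≤ r3 x := by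
  have hL1 : 1 ≤ Real.log x := by
    rw [Real.le_log_iff_exp_le (by linarith)]
    linarith [Real.exp_one_lt_d9]
  refine le_trans ?_ (r3_ge hx)
  calc ∑ n ∈ belowRange x, Λ n / (x / (n : ℝ) - 1)
      ≤ ∑ n ∈ belowRange x, x * (Λ n / (x - n)) :=
        sum_le_sum fun n hn => vonMangoldt_term_le hn
    _ = x * ∑ n ∈ belowRange x, Λ n / (x - n) := by rw [mul_sum]
    _ ≤ x * (Real.log x * (46 / 15 * Real.log (Real.log x) + 3.92)) := by
        gcongr
        rcases le_total (Real.log x) 10 with h | h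
        · refine (sum_vonMangoldt_div_le_trivial hx).trans ?_
          exact mul_le_mul_of_nonneg_left (add_le_log_bound hL1 h) (by linarith)
        · have hx' : 20000 ≤ x := by
            rw [Real.le_log_iff_exp_le (by linarith)] at h
            refine le_trans ?_ h
            have : Real.exp 10 = Real.exp 1 ^ 10 := by rw [← Real.exp_nat_mul]; norm_num
            rw [this]
            calc (20000 : ℝ) ≤ 2.7 ^ 10 := by norm_num
              _ ≤ Real.exp 1 ^ 10 := by
                gcongr
                linarith [Real.exp_one_gt_d9]
          refine (sum_vonMangoldt_div_le_of_large hx' h).trans ?_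
          have := Real.log_nonneg hL1
          exact mul_le_mul_of_nonneg_left (by linarith) (by linarith)
end

section
/- For all real x ≥ 3, the sum over integers n with x + 1.5 ≤ n < 2x of Λ(n)/(1 - x/n) is at most 2·r₃(x), where r₃(x) is as defined: r₃(x) := x log x · ( (2/3)(4 + 1/log 2) + 2 log log x + 2/log x + (16/15) log(log x / log 2) + (π²/6 - 1)·( 2/(1 + √(x-1.5) - √x) - (1/√x)(1 - log((√2-1)/(√2+1))) ) ). -/
open Real Finset ArithmeticFunction

open scoped ArithmeticFunction.Moebius

/-- The sum of `1 / φ k` over the squarefree `k ≤ z`. -/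
noncomputable def selbergSum (z : ℕ) : ℝ :=
  ∑ k ∈ (Icc 1 z).filter Squarefree, 1 / (k.totient : ℝ)

/-- The optimal weights in Selberg's upper bound sieve of level `z ^ 2`. -/
noncomputable def selbergWeight (z d : ℕ) : ℝ :=
  (μ d : ℝ) * d / selbergSum z *
    ∑ k ∈ (Icc 1 z).filter (fun k => Squarefree k ∧ d ∣ k), 1 / (k.totient : ℝ)

lemma selbergSum_pos {z : ℕ} (hz : 1 ≤ z) : 0 < selbergSum z := by
  refine Finset.sum_pos (fun k hk => ?_) ⟨1, by simp [hz]⟩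
  have : 0 < k.totient := Nat.totient_pos.2 (by simp at hk; omega)
  positivity

lemma sum_divisors_inv_totient {d : ℕ} (hd : Squarefree d) :
    ∑ l ∈ d.divisors, 1 / (l.totient : ℝ) = d / d.totient := by
  have h0 : 0 < d := Nat.pos_of_ne_zero hd.ne_zero
  have hsum : ∑ l ∈ d.divisors, ((d / l).totient : ℝ) = d := by
    rw [Nat.sum_div_divisors d (fun l => (l.totient : ℝ))]
    exact_mod_cast Nat.sum_totient d
  rw [eq_div_iff (by exact_mod_cast (Nat.totient_pos.2 h0).ne'), sum_mul]
  refine (Finset.sum_congr rfl fun l hl => ?_).trans hsum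
  obtain ⟨m, rfl⟩ := Nat.dvd_of_mem_divisors hl
  have hl0 : 0 < l := Nat.pos_of_mul_pos_right h0
  rw [Nat.mul_div_cancel_left _ hl0, Nat.totient_mul (Nat.coprime_of_squarefree_mul hd)]
  have : (l.totient : ℝ) ≠ 0 := by exact_mod_cast (Nat.totient_pos.2 hl0).ne'
  push_cast
  field_simp

lemma mul_sum_dvd_le_selbergSum (z : ℕ) {d : ℕ} (hd : Squarefree d) :
    d * ∑ k ∈ (Icc 1 z).filter (fun k => Squarefree k ∧ d ∣ k), 1 / (k.totient : ℝ)
      ≤ selbergSum z := by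
  have h0 : 0 < d := Nat.pos_of_ne_zero hd.ne_zero
  set M := (Icc 1 z).filter (fun m => d * m ≤ z ∧ Squarefree (d * m)) with hM
  have hsum : ∑ k ∈ (Icc 1 z).filter (fun k => Squarefree k ∧ d ∣ k), 1 / (k.totient : ℝ)
      = ∑ m ∈ M, 1 / ((d.totient : ℝ) * m.totient) := by
    symm
    refine Finset.sum_bij (fun m _ => d * m) ?_ ?_ ?_ ?_
    · intro m hm
      simp only [hM, mem_filter, mem_Icc] at hm ⊢
      exact ⟨⟨Nat.mul_pos h0 hm.1.1, hm.2.1⟩, hm.2.2, dvd_mul_right _ _⟩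
    · intro a _ b _ h
      exact Nat.eq_of_mul_eq_mul_left h0 h
    · intro k hk
      simp only [mem_filter, mem_Icc] at hk
      obtain ⟨⟨h1, h2⟩, h3, m, rfl⟩ := hk
      refine ⟨m, ?_, rfl⟩
      simp only [hM, mem_filter, mem_Icc]
      exact ⟨⟨Nat.pos_of_mul_pos_left h1, (Nat.le_mul_of_pos_left m h0).trans h2⟩, h2, h3⟩
    · intro m hm
      simp only [hM, mem_filter, mem_Icc] at hm
      rw [Nat.totient_mul (Nat.coprime_of_squarefree_mul hm.2.2)]
      push_cast
      rfl
  have hcop : ∀ m ∈ M, ∀ l ∈ d.divisors, l.Coprime m := fun m hm l hl =>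
    (Nat.coprime_of_squarefree_mul (mem_filter.1 hm).2.2).coprime_dvd_left
      (Nat.dvd_of_mem_divisors hl)
  have hprod : d * ∑ m ∈ M, 1 / ((d.totient : ℝ) * m.totient)
      = ∑ p ∈ M ×ˢ d.divisors, 1 / ((p.2 * p.1).totient : ℝ) := by
    rw [Finset.sum_product, mul_sum]
    refine Finset.sum_congr rfl fun m hm => ?_
    have : ∀ l ∈ d.divisors, 1 / ((l * m).totient : ℝ)
        = 1 / (m.totient : ℝ) * (1 / (l.totient : ℝ)) := fun l hl => by
      rw [Nat.totient_mul (hcop m hm l hl)]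
      push_cast
      rw [one_div_mul_one_div, mul_comm]
    rw [Finset.sum_congr rfl this, ← mul_sum, sum_divisors_inv_totient hd]
    ring
  rw [hsum, hprod, selbergSum]
  rw [← Finset.sum_image (s := M ×ˢ d.divisors) (g := fun p => p.2 * p.1)
    (f := fun k => 1 / (k.totient : ℝ))]
  · refine Finset.sum_le_sum_of_subset_of_nonneg ?_ fun _ _ _ => by positivity
    intro k hk
    simp only [mem_image, mem_product, Prod.exists] at hk
    obtain ⟨m, l, ⟨hm, hl⟩, rfl⟩ := hk
    have hld := Nat.dvd_of_mem_divisors hl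
    simp only [hM, mem_filter, mem_Icc] at hm ⊢
    refine ⟨⟨Nat.mul_pos (Nat.pos_of_mem_divisors hl) hm.1.1, ?_⟩, ?_⟩
    · exact (Nat.mul_le_mul_right m (Nat.le_of_dvd h0 hld)).trans hm.2.1
    · exact hm.2.2.squarefree_of_dvd (Nat.mul_dvd_mul_right hld m)
  · rintro ⟨m, l⟩ hp ⟨m', l'⟩ hp' h
    simp only [coe_product, Set.mem_prod, mem_coe] at hp hp' h
    have key : ∀ m ∈ M, ∀ l ∈ d.divisors, (l * m).gcd d = l := fun m hm l hl => by
      rw [Nat.Coprime.gcd_mul_right_cancel l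
        (Nat.coprime_of_squarefree_mul (mem_filter.1 hm).2.2).symm]
      exact Nat.gcd_eq_left (Nat.dvd_of_mem_divisors hl)
    have hl : l = l' := by rw [← key m hp.1 l hp.2, h, key m' hp'.1 l' hp'.2]
    subst hl
    rw [Nat.eq_of_mul_eq_mul_left (Nat.pos_of_mem_divisors hp.2) h]

lemma abs_selbergWeight_le_one {z : ℕ} (hz : 1 ≤ z) (d : ℕ) : |selbergWeight z d| ≤ 1 := by
  have hS := selbergSum_pos hz
  by_cases hd : Squarefree d
  · have h := mul_sum_dvd_le_selbergSum z hd
    have hμ : |(μ d : ℝ)| = 1 := by exact_mod_cast abs_moebius_eq_one_of_squarefree hd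
    have hnn : 0 ≤ ∑ k ∈ (Icc 1 z).filter (fun k => Squarefree k ∧ d ∣ k),
        1 / (k.totient : ℝ) := Finset.sum_nonneg fun _ _ => by positivity
    rw [selbergWeight, abs_mul, abs_div, abs_mul, hμ, abs_of_nonneg hnn, abs_of_pos hS,
      Nat.abs_cast, one_mul, div_mul_eq_mul_div]
    exact (div_le_one hS).2 h
  · simp [selbergWeight, moebius_eq_zero_of_not_squarefree hd]

lemma selbergWeight_one {z : ℕ} (hz : 1 ≤ z) : selbergWeight z 1 = 1 := by
  have hS := (selbergSum_pos hz).ne'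
  have : (Icc 1 z).filter (fun k => Squarefree k ∧ 1 ∣ k) = (Icc 1 z).filter Squarefree := by
    simp
  rw [selbergWeight, this, ← selbergSum]
  simp [hS]

lemma sum_divisors_filter_dvd_moebius {k : ℕ} (hk : Squarefree k) (f : ℕ) :
    ∑ d ∈ k.divisors.filter (f ∣ ·), (μ d : ℝ) = if f = k then (μ k : ℝ) else 0 := by
  by_cases hf : f ∣ k
  · obtain ⟨m, rfl⟩ := hf
    have h0 : 0 < f * m := Nat.pos_of_ne_zero hk.ne_zero
    have hf0 : 0 < f := Nat.pos_of_mul_pos_right h0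
    have hcop := Nat.coprime_of_squarefree_mul hk
    have h1 : ∑ d ∈ (f * m).divisors.filter (f ∣ ·), (μ d : ℝ)
        = ∑ e ∈ m.divisors, (μ f : ℝ) * μ e := by
      symm
      refine Finset.sum_bij (fun e _ => f * e) ?_ ?_ ?_ ?_
      · intro e he
        simp only [mem_filter, Nat.mem_divisors] at he ⊢
        exact ⟨⟨Nat.mul_dvd_mul_left f he.1, h0.ne'⟩, dvd_mul_right _ _⟩
      · intro a _ b _ h
        exact Nat.eq_of_mul_eq_mul_left hf0 h
      · intro d hd
        simp only [mem_filter, Nat.mem_divisors] at hd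
        obtain ⟨⟨h1, -⟩, e, rfl⟩ := hd
        exact ⟨e, Nat.mem_divisors.2 ⟨Nat.dvd_of_mul_dvd_mul_left hf0 h1, by aesop⟩, rfl⟩
      · intro e he
        rw [isMultiplicative_moebius.map_mul_of_coprime
          (hcop.coprime_dvd_right (Nat.dvd_of_mem_divisors he))]
        push_cast
        rfl
    have h2 : ∑ e ∈ m.divisors, (μ e : ℝ) = if m = 1 then 1 else 0 := by
      have := congrArg (fun g : ArithmeticFunction ℤ => g m) moebius_mul_coe_zeta
      simp only [coe_mul_zeta_apply, one_apply] at this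
      exact_mod_cast this
    rw [h1, ← mul_sum, h2]
    by_cases hm : m = 1
    · simp [hm]
    · have : f ≠ f * m := fun h => hm (Nat.eq_of_mul_eq_mul_left hf0 (by omega))
      simp [hm, this]
  · rw [if_neg (by rintro rfl; exact hf dvd_rfl), Finset.filter_false_of_mem, sum_empty]
    exact fun d hd h => hf (h.trans (Nat.dvd_of_mem_divisors hd))

lemma sum_dvd_selbergWeight_div (z : ℕ) {f : ℕ} (hf : f ∈ Icc 1 z) :
    ∑ d ∈ (Icc 1 z).filter (f ∣ ·), selbergWeight z d / d
      = (μ f : ℝ) / (selbergSum z * f.totient) := by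
  have h1 : ∀ d ∈ (Icc 1 z).filter (f ∣ ·), selbergWeight z d / d
      = ∑ k ∈ (Icc 1 z).filter Squarefree,
          if d ∣ k then (μ d : ℝ) * (1 / (selbergSum z * k.totient)) else 0 := fun d hd => by
    have : (d : ℝ) ≠ 0 := by
      simp only [mem_filter, mem_Icc] at hd
      exact_mod_cast (by omega : d ≠ 0)
    rw [← Finset.sum_filter, Finset.filter_filter, selbergWeight, mul_sum, sum_div]
    refine Finset.sum_congr rfl fun k _ => ?_
    field_simp
  have h2 : ∀ k ∈ (Icc 1 z).filter Squarefree,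
      ∑ d ∈ (Icc 1 z).filter (f ∣ ·),
          (if d ∣ k then (μ d : ℝ) * (1 / (selbergSum z * k.totient)) else 0)
        = if f = k then (μ k : ℝ) / (selbergSum z * k.totient) else 0 := fun k hk => by
    simp only [mem_filter, mem_Icc] at hk
    rw [← Finset.sum_filter, ← sum_mul]
    have : ((Icc 1 z).filter (f ∣ ·)).filter (· ∣ k) = k.divisors.filter (f ∣ ·) := by
      ext d
      simp only [mem_filter, mem_Icc, Nat.mem_divisors]
      constructor
      · rintro ⟨⟨-, h2⟩, h3⟩
        exact ⟨⟨h3, by omega⟩, h2⟩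
      · rintro ⟨⟨h3, h4⟩, h2⟩
        exact ⟨⟨⟨Nat.pos_of_dvd_of_pos h3 (by omega),
          (Nat.le_of_dvd (by omega) h3).trans hk.1.2⟩, h2⟩, h3⟩
    rw [this, sum_divisors_filter_dvd_moebius hk.2]
    split_ifs <;> simp [div_eq_mul_inv]
  rw [Finset.sum_congr rfl h1, Finset.sum_comm, Finset.sum_congr rfl h2, Finset.sum_ite_eq]
  by_cases hsq : Squarefree f
  · simp [hsq, hf]
  · simp [hsq, moebius_eq_zero_of_not_squarefree hsq]

lemma sum_selbergWeight_gcd {z : ℕ} (hz : 1 ≤ z) :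
    ∑ d ∈ Icc 1 z, ∑ e ∈ Icc 1 z,
      selbergWeight z d * selbergWeight z e * (1 / (d.lcm e : ℝ)) = 1 / selbergSum z := by
  have hS := (selbergSum_pos hz).ne'
  have h1 : ∀ d ∈ Icc 1 z, ∀ e ∈ Icc 1 z,
      selbergWeight z d * selbergWeight z e * (1 / (d.lcm e : ℝ))
        = ∑ f ∈ Icc 1 z, (f.totient : ℝ) * ((if f ∣ d then selbergWeight z d / d else 0)
            * (if f ∣ e then selbergWeight z e / e else 0)) := fun d hd e he => by
    simp only [mem_Icc] at hd he
    have hg : (Nat.gcd d e : ℝ) = ∑ f ∈ Icc 1 z, if f ∣ d ∧ f ∣ e then (f.totient : ℝ) else 0 := by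
      rw [← Finset.sum_filter]
      conv_lhs => rw [← Nat.sum_totient (d.gcd e)]
      push_cast
      refine Finset.sum_congr ?_ fun _ _ => rfl
      ext f
      simp only [Nat.mem_divisors, mem_filter, mem_Icc, Nat.dvd_gcd_iff]
      constructor
      · rintro ⟨h, -⟩
        have := Nat.le_of_dvd (by omega) h.1
        have := Nat.pos_of_dvd_of_pos h.1 (by omega)
        exact ⟨by omega, h⟩
      · rintro ⟨-, h⟩
        exact ⟨h, Nat.gcd_ne_zero_left (by omega)⟩
    have hd0 : (d : ℝ) ≠ 0 := by exact_mod_cast (by omega : d ≠ 0)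
    have he0 : (e : ℝ) ≠ 0 := by exact_mod_cast (by omega : e ≠ 0)
    have hl0 : (d.lcm e : ℝ) ≠ 0 := by exact_mod_cast Nat.lcm_ne_zero (by omega) (by omega)
    have hgl : (d.gcd e : ℝ) * d.lcm e = d * e := by exact_mod_cast Nat.gcd_mul_lcm d e
    have : (1 : ℝ) / d.lcm e = d.gcd e / (d * e) := by
      rw [div_eq_div_iff hl0 (mul_ne_zero hd0 he0), one_mul, hgl]
    rw [this, hg, sum_div, mul_sum]
    refine Finset.sum_congr rfl fun f _ => ?_
    by_cases h1 : f ∣ d <;> by_cases h2 : f ∣ e <;> simp [h1, h2]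
    field_simp
  rw [Finset.sum_congr rfl fun d hd => Finset.sum_congr rfl (h1 d hd)]
  rw [Finset.sum_congr rfl fun d _ => Finset.sum_comm, Finset.sum_comm]
  have h2 : ∀ f ∈ Icc 1 z, ∑ d ∈ Icc 1 z, ∑ e ∈ Icc 1 z,
      (f.totient : ℝ) * ((if f ∣ d then selbergWeight z d / d else 0)
            * (if f ∣ e then selbergWeight z e / e else 0))
        = if Squarefree f then 1 / selbergSum z ^ 2 * (1 / (f.totient : ℝ)) else 0 := fun f hf => by
    have hφ : (f.totient : ℝ) ≠ 0 := by
      have := Nat.totient_pos.2 (mem_Icc.1 hf).1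
      positivity
    simp_rw [← mul_sum]
    rw [← Finset.sum_mul, ← Finset.sum_filter, sum_dvd_selbergWeight_div z hf]
    split_ifs with hsq
    · have hμ : (μ f : ℝ) ^ 2 = 1 := by exact_mod_cast moebius_sq_eq_one_of_squarefree hsq
      field_simp
      exact hμ
    · simp [moebius_eq_zero_of_not_squarefree hsq]
  rw [Finset.sum_congr rfl h2, ← Finset.sum_filter, ← mul_sum, ← selbergSum]
  field_simp

lemma sum_inv_radical_eq_le {k : ℕ} (hk : Squarefree k) (z : ℕ) :
    ∑ n ∈ (Icc 1 z).filter (fun n => ∏ p ∈ n.primeFactors, p = k), 1 / (n : ℝ)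
      ≤ 1 / (k.totient : ℝ) := by
  have hk0 : 0 < k := Nat.pos_of_ne_zero hk.ne_zero
  have hkr : (0 : ℝ) < k := by exact_mod_cast hk0
  let f : ℕ →* ℝ :=
    { toFun := fun n => (n : ℝ)⁻¹
      map_one' := by simp
      map_mul' := fun a b => by push_cast; rw [mul_inv] }
  have hf : ∀ n, f n = (n : ℝ)⁻¹ := fun n => rfl
  have hs := (EulerProduct.summable_and_hasSum_factoredNumbers_prod_filter_prime_geometric
    (f := f) (fun {p} hp => by
      rw [hf, norm_inv, Real.norm_natCast]
      exact inv_lt_one_of_one_lt₀ (by exact_mod_cast hp.one_lt)) k.primeFactors).2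
  have hfil : (k.primeFactors.filter fun p => p.Prime) = k.primeFactors :=
    Finset.filter_true_of_mem fun p hp => Nat.prime_of_mem_primeFactors hp
  have hval : ∏ p ∈ k.primeFactors, (1 - f p)⁻¹ = k / k.totient := by
    have h := Nat.totient_eq_mul_prod_factors k
    have h' : (k.totient : ℝ) = k * ∏ p ∈ k.primeFactors, (1 - (p : ℝ)⁻¹) := by
      have h' := congrArg (fun q : ℚ => (q : ℝ)) h
      push_cast at h'
      exact h'
    simp only [hf]
    rw [h', Finset.prod_inv_distrib, div_mul_cancel_left₀ hkr.ne']
  rw [hfil, hval] at hs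
  set A := (Icc 1 z).filter (fun n => ∏ p ∈ n.primeFactors, p = k) with hA
  have hmem : ∀ n ∈ A, k ∣ n ∧ n / k ∈ Nat.factoredNumbers k.primeFactors := fun n hn => by
    simp only [hA, mem_filter, mem_Icc] at hn
    have hkn : k ∣ n := hn.2 ▸ Nat.prod_primeFactors_dvd n
    refine ⟨hkn, Nat.mem_factoredNumbers_of_primeFactors_subset ?_ ?_⟩
    · exact (Nat.div_pos (Nat.le_of_dvd hn.1.1 hkn) hk0).ne'
    · intro p hp
      have hpp := Nat.prime_of_mem_primeFactors hp
      have hpn : p ∈ n.primeFactors :=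
        Nat.primeFactors_mono (Nat.div_dvd_of_dvd hkn) (by omega) hp
      exact Nat.mem_primeFactors.2 ⟨hpp, hn.2 ▸ Finset.dvd_prod_of_mem _ hpn, hk0.ne'⟩
  have hle := sum_le_hasSum
    (A.attach.image fun n => (⟨n.1 / k, (hmem n.1 n.2).2⟩ : Nat.factoredNumbers k.primeFactors))
    (fun m _ => by rw [hf]; positivity) hs
  rw [Finset.sum_image] at hle
  · have h2 : ∑ n ∈ A, 1 / (n : ℝ) = 1 / k * ∑ n ∈ A.attach, f (n.1 / k) := by
      rw [mul_sum, ← Finset.sum_attach]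
      refine Finset.sum_congr rfl fun n _ => ?_
      rw [hf, Nat.cast_div (hmem n.1 n.2).1 hkr.ne', inv_div, one_div_mul_eq_div, div_div,
        mul_comm, ← div_div, div_self hkr.ne']
    rw [h2]
    calc 1 / (k : ℝ) * ∑ n ∈ A.attach, f (n.1 / k) ≤ 1 / k * (k / k.totient) :=
          mul_le_mul_of_nonneg_left hle (by positivity)
      _ = 1 / (k.totient : ℝ) := by field_simp
  · intro a _ b _ h
    have h' : a.1 / k = b.1 / k := congrArg Subtype.val h
    exact Subtype.ext ((Nat.div_left_inj (hmem a.1 a.2).1 (hmem b.1 b.2).1).1 h')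

lemma log_add_one_le_selbergSum (z : ℕ) : Real.log (z + 1) ≤ selbergSum z := by
  have h1 : Real.log (z + 1) ≤ ∑ n ∈ Icc 1 z, 1 / (n : ℝ) := by
    have := log_add_one_le_harmonic z
    rw [harmonic_eq_sum_Icc] at this
    push_cast at this
    simpa using this
  refine h1.trans ?_
  have hmaps : ∀ n ∈ Icc 1 z, ∏ p ∈ n.primeFactors, p ∈ (Icc 1 z).filter Squarefree :=
    fun n hn => by
      simp only [mem_Icc, mem_filter] at hn ⊢
      refine ⟨⟨Finset.prod_pos fun p hp => (Nat.prime_of_mem_primeFactors hp).pos,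
        (Nat.le_of_dvd hn.1 (Nat.prod_primeFactors_dvd n)).trans hn.2⟩, ?_⟩
      refine Finset.squarefree_prod_of_pairwise_isCoprime ?_ ?_
      · intro p hp q hq hpq
        exact Nat.coprime_iff_isRelPrime.1 ((Nat.coprime_primes (Nat.prime_of_mem_primeFactors hp)
          (Nat.prime_of_mem_primeFactors hq)).2 hpq)
      · exact fun p hp => (Nat.prime_of_mem_primeFactors hp).prime.squarefree
  rw [← Finset.sum_fiberwise_of_maps_to hmaps, selbergSum]
  exact Finset.sum_le_sum fun k hk => sum_inv_radical_eq_le (mem_filter.1 hk).2 z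

lemma abs_card_Ico_filter_dvd_sub_le (a N : ℕ) {m : ℕ} (hm : 0 < m) :
    |(((Ico a (a + N)).filter (m ∣ ·)).card : ℝ) - N * (1 / m)| ≤ 1 := by
  have h := Int.Ico_filter_dvd_card (a : ℤ) ((a : ℤ) + N) (r := (m : ℤ)) (by exact_mod_cast hm)
  have hc : (((Ico a (a + N)).filter (m ∣ ·)).card : ℤ)
      = ((Ico (a : ℤ) (a + N)).filter ((m : ℤ) ∣ ·)).card := by
    have : ((Ico (a : ℤ) (a + N)).filter ((m : ℤ) ∣ ·))
        = ((Ico a (a + N)).filter (m ∣ ·)).image (fun n : ℕ => (n : ℤ)) := by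
      ext y
      simp only [mem_filter, mem_Ico, mem_image]
      constructor
      · rintro ⟨⟨h1, h2⟩, h3⟩
        lift y to ℕ using by omega
        exact ⟨y, ⟨by omega, by exact_mod_cast h3⟩, rfl⟩
      · rintro ⟨n, ⟨h1, h3⟩, rfl⟩
        exact ⟨by omega, by exact_mod_cast h3⟩
    rw [this, Finset.card_image_of_injective _ Nat.cast_injective]
  rw [← hc] at h
  have hmq : (0 : ℚ) < m := by exact_mod_cast hm
  set u : ℤ := ⌈(((a : ℤ) + N : ℤ) : ℚ) / ((m : ℤ) : ℚ)⌉ with hu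
  set v : ℤ := ⌈((a : ℤ) : ℚ) / ((m : ℤ) : ℚ)⌉ with hv
  have hvu : v ≤ u := by
    apply Int.ceil_le_ceil
    push_cast
    gcongr
    simp
  rw [max_eq_left (by omega)] at h
  have hu1 := Int.le_ceil ((((a : ℤ) + N : ℤ) : ℚ) / ((m : ℤ) : ℚ))
  have hu2 := Int.ceil_lt_add_one ((((a : ℤ) + N : ℤ) : ℚ) / ((m : ℤ) : ℚ))
  have hv1 := Int.le_ceil (((a : ℤ) : ℚ) / ((m : ℤ) : ℚ))
  have hv2 := Int.ceil_lt_add_one (((a : ℤ) : ℚ) / ((m : ℤ) : ℚ))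
  rw [← hu] at hu1 hu2
  rw [← hv] at hv1 hv2
  push_cast at hu1 hu2 hv1 hv2
  rw [add_div] at hu1 hu2
  have hq : |(((Ico a (a + N)).filter (m ∣ ·)).card : ℚ) - N * (1 / m)| ≤ 1 := by
    have h' : (((Ico a (a + N)).filter (m ∣ ·)).card : ℚ) = u - v := by exact_mod_cast h
    rw [h', abs_le, mul_one_div]
    constructor <;> linarith
  have hr := (Rat.cast_le (K := ℝ)).2 hq
  push_cast at hr
  exact hr

lemma sum_Ico_sq_sum_selbergWeight_le {z : ℕ} (hz : 1 ≤ z) (a N : ℕ) :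
    ∑ n ∈ Ico a (a + N), (∑ d ∈ (Icc 1 z).filter (· ∣ n), selbergWeight z d) ^ 2
      ≤ N / selbergSum z + z ^ 2 := by
  set w := selbergWeight z
  have h1 : ∀ n ∈ Ico a (a + N), (∑ d ∈ (Icc 1 z).filter (· ∣ n), w d) ^ 2
      = ∑ d ∈ Icc 1 z, ∑ e ∈ Icc 1 z, w d * w e * (if d.lcm e ∣ n then 1 else 0) := fun n _ => by
    rw [sq, Finset.sum_filter, Finset.sum_mul_sum]
    refine Finset.sum_congr rfl fun d _ => Finset.sum_congr rfl fun e _ => ?_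
    by_cases hd : d ∣ n <;> by_cases he : e ∣ n <;> simp [Nat.lcm_dvd_iff, hd, he]
  have h2 : ∑ n ∈ Ico a (a + N), (∑ d ∈ (Icc 1 z).filter (· ∣ n), w d) ^ 2
      = ∑ d ∈ Icc 1 z, ∑ e ∈ Icc 1 z,
          w d * w e * (((Ico a (a + N)).filter (d.lcm e ∣ ·)).card : ℝ) := by
    rw [Finset.sum_congr rfl h1, Finset.sum_comm]
    refine Finset.sum_congr rfl fun d _ => ?_
    rw [Finset.sum_comm]
    refine Finset.sum_congr rfl fun e _ => ?_
    rw [← mul_sum, Finset.sum_boole]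
  have h3 : ∀ d ∈ Icc 1 z, ∀ e ∈ Icc 1 z,
      w d * w e * (((Ico a (a + N)).filter (d.lcm e ∣ ·)).card : ℝ)
        ≤ N * (w d * w e * (1 / (d.lcm e : ℝ))) + 1 := fun d hd e he => by
    simp only [mem_Icc] at hd he
    have hc := abs_card_Ico_filter_dvd_sub_le a N (Nat.lcm_pos hd.1 he.1)
    set c := (((Ico a (a + N)).filter (d.lcm e ∣ ·)).card : ℝ)
    have hle : |w d * w e * (c - N * (1 / (d.lcm e : ℝ)))| ≤ 1 := by
      rw [abs_mul, abs_mul]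
      exact mul_le_one₀ (mul_le_one₀ (abs_selbergWeight_le_one hz d) (abs_nonneg _)
        (abs_selbergWeight_le_one hz e)) (abs_nonneg _) hc
    have := (abs_le.1 hle).2
    linarith
  rw [h2]
  refine (Finset.sum_le_sum fun d hd => Finset.sum_le_sum (h3 d hd)).trans (le_of_eq ?_)
  simp_rw [Finset.sum_add_distrib, ← mul_sum]
  rw [sum_selbergWeight_gcd hz]
  simp
  ring

/-- An upper bound for the number of prime powers in a short interval, from Selberg's sieve. -/
lemma card_isPrimePow_Ico_le {z : ℕ} (hz : 1 ≤ z) (a N : ℕ) :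
    (((Ico a (a + N)).filter fun n => IsPrimePow n ∧ n < 2 * a).card : ℝ)
      ≤ N / selbergSum z + z ^ 2 + z := by
  set T := (Ico a (a + N)).filter fun n => IsPrimePow n ∧ n < 2 * a with hT
  have hsplit := Finset.card_filter_add_card_filter_not (s := T) (fun n => z < n.minFac)
  have hrough : ((T.filter fun n => z < n.minFac).card : ℝ) ≤ N / selbergSum z + z ^ 2 := by
    refine le_trans ?_ (sum_Ico_sq_sum_selbergWeight_le hz a N)
    rw [Finset.card_eq_sum_ones, Nat.cast_sum]
    refine (Finset.sum_le_sum (f := fun _ => ((1 : ℕ) : ℝ))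
      (g := fun n => (∑ d ∈ (Icc 1 z).filter (· ∣ n), selbergWeight z d) ^ 2)
      fun n hn => ?_).trans
      (Finset.sum_le_sum_of_subset_of_nonneg ?_ fun _ _ _ => sq_nonneg _)
    · have : (Icc 1 z).filter (· ∣ n) = {1} := by
        ext d
        simp only [mem_filter, mem_Icc, mem_singleton]
        constructor
        · rintro ⟨⟨h1, h2⟩, h3⟩
          by_contra hd
          have h4 := Nat.minFac_le_of_dvd (by omega : 2 ≤ d) h3
          have h5 := (mem_filter.1 hn).2
          omega
        · rintro rfl
          exact ⟨⟨le_rfl, hz⟩, one_dvd _⟩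
      simp [this, selbergWeight_one hz]
    · exact (Finset.filter_subset _ _).trans (Finset.filter_subset _ _)
  have hsmooth : (T.filter fun n => ¬ z < n.minFac).card ≤ z := by
    calc (T.filter fun n => ¬ z < n.minFac).card ≤ (Icc 1 z).card := by
          refine Finset.card_le_card_of_injOn Nat.minFac ?_ ?_
          · intro n hn
            have := (mem_filter.1 hn).2
            have := n.minFac_pos
            simp only [coe_Icc, Set.mem_Icc]
            omega
          · have key : ∀ m n, m ∈ T → n ∈ T → m.minFac = n.minFac → m ≤ n → m = n := by
              intro m n hm hn hmn hle
              simp only [hT, mem_filter, mem_Ico] at hm hn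
              obtain ⟨p, j, hp, hj, rfl⟩ := (isPrimePow_nat_iff _).1 hm.2.1
              obtain ⟨q, k, hq, hk, rfl⟩ := (isPrimePow_nat_iff _).1 hn.2.1
              rw [hp.pow_minFac hj.ne', hq.pow_minFac hk.ne'] at hmn
              subst hmn
              have hjk : j ≤ k := (Nat.pow_le_pow_iff_right hp.one_lt).1 hle
              rcases hjk.eq_or_lt with rfl | hlt
              · rfl
              · have : p ^ (j + 1) ≤ p ^ k := Nat.pow_le_pow_right hp.pos hlt
                have h2 : p ^ j * 2 ≤ p ^ (j + 1) := by
                  rw [pow_succ]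
                  exact Nat.mul_le_mul_left _ hp.two_le
                omega
            intro m hm n hn hmn
            have hm' := (mem_filter.1 hm).1
            have hn' := (mem_filter.1 hn).1
            rcases le_total m n with h | h
            · exact key m n hm' hn' hmn h
            · exact (key n m hn' hm' hmn.symm h).symm
      _ = z := by simp
  have : (T.card : ℝ) = (T.filter fun n => z < n.minFac).card
      + (T.filter fun n => ¬ z < n.minFac).card := by exact_mod_cast hsplit.symm
  have : ((T.filter fun n => ¬ z < n.minFac).card : ℝ) ≤ z := by exact_mod_cast hsmooth
  linarith

lemma card_isPrimePow_Ico_two_pow_div_le {i j : ℕ} (hi : 1 ≤ i) (hij : 3 * i ≤ j) (a : ℕ) :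
    (((Ico a (a + 2 ^ j)).filter fun n => IsPrimePow n ∧ n < 2 * a).card : ℝ) / 2 ^ j
      ≤ 1 / (i * Real.log 2) + 2 / 2 ^ i := by
  have hl2 : 0 < Real.log 2 := Real.log_pos one_lt_two
  have hi' : (0 : ℝ) < i := by exact_mod_cast hi
  have h := card_isPrimePow_Ico_le (Nat.one_le_two_pow (n := i)) a (2 ^ j)
  have hS : i * Real.log 2 ≤ selbergSum (2 ^ i) := by
    refine le_trans ?_ (log_add_one_le_selbergSum _)
    rw [← Real.log_pow]
    refine Real.log_le_log (by positivity) ?_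
    push_cast
    linarith
  have hy : (1 : ℝ) ≤ 2 ^ i := one_le_pow₀ one_le_two
  have hj : ((2 : ℝ) ^ i) ^ 3 ≤ 2 ^ j := by
    rw [← pow_mul, mul_comm]
    exact pow_le_pow_right₀ one_le_two hij
  push_cast at h
  rw [div_le_iff₀ (by positivity)]
  refine h.trans ?_
  have h1 : (2 : ℝ) ^ j / selbergSum (2 ^ i) ≤ 1 / (i * Real.log 2) * 2 ^ j := by
    rw [one_div_mul_eq_div]
    gcongr
  have h2 : ((2 : ℝ) ^ i) ^ 2 + 2 ^ i ≤ 2 / 2 ^ i * 2 ^ j := by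
    rw [div_mul_eq_mul_div, le_div_iff₀ (by positivity)]
    nlinarith [sq_nonneg ((2 : ℝ) ^ i)]
  linarith

lemma sum_range_three_mul_le {w : ℕ → ℝ} (h1 : ∀ j, w j ≤ 1)
    (h2 : ∀ i j : ℕ, 1 ≤ i → 3 * i ≤ j → w j ≤ 1 / (i * Real.log 2) + 2 / 2 ^ i)
    {I : ℕ} (hI : 2 ≤ I) :
    ∑ j ∈ range (3 * (I + 1)), w j
      ≤ 21 / 2 - 12 / 2 ^ (I + 1) + 3 / Real.log 2 * (Real.log I - Real.log 2) := by
  have hl2 : 0 < Real.log 2 := Real.log_pos one_lt_two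
  induction I, hI using Nat.le_induction with
  | base =>
    have : ∑ j ∈ range (3 * (2 + 1)), w j ≤ ∑ j ∈ range 9, (1 : ℝ) :=
      Finset.sum_le_sum fun j _ => h1 j
    norm_num at this ⊢
    exact this
  | succ I hI ih =>
    have hI0 : (0 : ℝ) < I := by exact_mod_cast (by omega : 0 < I)
    have hsum : ∑ j ∈ range (3 * (I + 1 + 1)), w j = ∑ j ∈ range (3 * (I + 1)), w j
        + w (3 * (I + 1)) + w (3 * (I + 1) + 1) + w (3 * (I + 1) + 2) := by
      rw [show 3 * (I + 1 + 1) = 3 * (I + 1) + 1 + 1 + 1 by ring, Finset.sum_range_succ,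
        Finset.sum_range_succ, Finset.sum_range_succ]
    have hw0 := h2 (I + 1) (3 * (I + 1)) (by omega) le_rfl
    have hw1 := h2 (I + 1) (3 * (I + 1) + 1) (by omega) (by omega)
    have hw2 := h2 (I + 1) (3 * (I + 1) + 2) (by omega) (by omega)
    have hlog : 1 / ((I : ℝ) + 1) ≤ Real.log (I + 1) - Real.log I := by
      have := Real.log_le_sub_one_of_pos (x := (I : ℝ) / (I + 1)) (by positivity)
      rw [Real.log_div hI0.ne' (by positivity)] at this
      have h3 : (I : ℝ) / (I + 1) - 1 = -(1 / (I + 1)) := by field_simp; ring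
      linarith
    have hstep : 3 * (1 / (((I : ℝ) + 1) * Real.log 2))
        ≤ 3 / Real.log 2 * (Real.log (I + 1) - Real.log I) := by
      calc 3 * (1 / (((I : ℝ) + 1) * Real.log 2)) = 3 / Real.log 2 * (1 / ((I : ℝ) + 1)) := by
            field_simp
        _ ≤ _ := by gcongr
    have hpow : (12 : ℝ) / 2 ^ (I + 1) - 12 / 2 ^ (I + 1 + 1) = 3 * (2 / 2 ^ (I + 1)) := by
      rw [pow_succ 2 (I + 1)]
      field_simp
      norm_num
    push_cast at hw0 hw1 hw2 ⊢
    linarith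

lemma le_r3 {x : ℝ} (hx : 3 ≤ x) :
    x * (Real.log x * (3.6 + (46 / 15) * Real.log (Real.log x)) + 2) ≤ r3 x := by
  have hl2 : 0 < Real.log 2 := Real.log_pos one_lt_two
  have hl2' := Real.log_two_lt_d9
  have hL : 0 < Real.log x := Real.log_pos (by linarith)
  have h1 : 3.6 ≤ (2 / 3) * (4 + 1 / Real.log 2) := by
    have : 1.4 ≤ 1 / Real.log 2 := by
      rw [le_div_iff₀ hl2]
      linarith
    linarith
  have h2 : Real.log (Real.log x) ≤ Real.log (Real.log x / Real.log 2) := by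
    refine Real.log_le_log hL ?_
    rw [le_div_iff₀ hl2]
    nlinarith
  have hs2 : Real.sqrt 2 ^ 2 = 2 := Real.sq_sqrt zero_le_two
  have hs2' : 1 < Real.sqrt 2 := Real.lt_sqrt_of_sq_lt (by norm_num)
  have h3 : -2 ≤ Real.log ((Real.sqrt 2 - 1) / (Real.sqrt 2 + 1)) := by
    have heq : (Real.sqrt 2 - 1) / (Real.sqrt 2 + 1) = ((Real.sqrt 2 + 1) ^ 2)⁻¹ := by
      field_simp
      linarith
    have hlog : Real.log (Real.sqrt 2 + 1) ≤ 1 := by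
      rw [Real.log_le_iff_le_exp (by positivity)]
      have := Real.exp_one_gt_d9
      have : Real.sqrt 2 ≤ 1.5 := Real.sqrt_le_iff.2 ⟨by norm_num, by norm_num⟩
      linarith
    rw [heq, Real.log_inv, Real.log_pow]
    push_cast
    linarith
  have h4 : 2 ≤ 2 / (1 + Real.sqrt (x - 1.5) - Real.sqrt x) := by
    have hle : Real.sqrt (x - 1.5) ≤ Real.sqrt x := Real.sqrt_le_sqrt (by linarith)
    have hlt : Real.sqrt x < 1 + Real.sqrt (x - 1.5) := by
      have h5 : 1 ≤ Real.sqrt (x - 1.5) := Real.one_le_sqrt.2 (by linarith)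
      have h6 : Real.sqrt (x - 1.5) ^ 2 = x - 1.5 := Real.sq_sqrt (by linarith)
      rw [Real.sqrt_lt' (by linarith)]
      nlinarith
    rw [le_div_iff₀ (by linarith)]
    linarith
  have h5 : (1 / Real.sqrt x) * (1 - Real.log ((Real.sqrt 2 - 1) / (Real.sqrt 2 + 1))) ≤ 2 := by
    have : 1.5 ≤ Real.sqrt x := Real.le_sqrt_of_sq_le (by norm_num; linarith)
    rw [one_div_mul_eq_div, div_le_iff₀ (by linarith)]
    linarith
  have h6 : 0 ≤ (Real.pi ^ 2 / 6 - 1) *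
      (2 / (1 + Real.sqrt (x - 1.5) - Real.sqrt x)
        - (1 / Real.sqrt x) * (1 - Real.log ((Real.sqrt 2 - 1) / (Real.sqrt 2 + 1)))) := by
    have := Real.pi_gt_three
    exact mul_nonneg (by nlinarith) (by linarith)
  calc x * (Real.log x * (3.6 + (46 / 15) * Real.log (Real.log x)) + 2)
      = x * Real.log x * (3.6 + (46 / 15) * Real.log (Real.log x) + 2 / Real.log x) := by
        field_simp
    _ ≤ r3 x := by
        rw [r3]
        refine mul_le_mul_of_nonneg_left ?_ (by positivity)
        linarith

lemma one_lt_log_of_three_le {x : ℝ} (hx : 3 ≤ x) : 1 < Real.log x := by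
  rw [Real.lt_log_iff_exp_lt (by linarith)]
  linarith [Real.exp_one_lt_d9]

lemma log_two_mul_mul_le {x : ℝ} (hx : 3 ≤ x) {w : ℕ → ℝ} (h0 : ∀ j, 0 ≤ w j) (h1 : ∀ j, w j ≤ 1)
    (h2 : ∀ i j : ℕ, 1 ≤ i → 3 * i ≤ j → w j ≤ 1 / (i * Real.log 2) + 2 / 2 ^ i) :
    Real.log (2 * x) * (1 + ∑ j ∈ range (Nat.log 2 ⌊x⌋₊ + 1), w j)
      ≤ 2 * (Real.log x * (3.6 + (46 / 15) * Real.log (Real.log x)) + 2) := by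
  have hl2 := Real.log_two_lt_d9
  have hl2' := Real.log_two_gt_d9
  have hl2p : 0 < Real.log 2 := by linarith
  have hL := one_lt_log_of_three_le hx
  have hx0 : 0 < x := by linarith
  have hlog2x : Real.log (2 * x) = Real.log 2 + Real.log x := Real.log_mul two_ne_zero hx0.ne'
  set K := Nat.log 2 ⌊x⌋₊ with hK
  have hfloor : ⌊x⌋₊ ≠ 0 := (Nat.floor_pos.2 (by linarith)).ne'
  have hKL : K * Real.log 2 ≤ Real.log x := by
    rw [← Real.log_pow]
    refine Real.log_le_log (by positivity) ?_
    calc (2 : ℝ) ^ K ≤ (⌊x⌋₊ : ℝ) := by exact_mod_cast Nat.pow_log_le_self 2 hfloor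
      _ ≤ x := Nat.floor_le hx0.le
  have hnn : 0 ≤ Real.log (Real.log x) := Real.log_nonneg hL.le
  rw [hlog2x]
  set L := Real.log x with hLdef
  rcases lt_or_ge K 6 with hK6 | hK6
  · have hsum : ∑ j ∈ range (K + 1), w j ≤ K + 1 := by
      calc ∑ j ∈ range (K + 1), w j ≤ ∑ j ∈ range (K + 1), (1 : ℝ) :=
            Finset.sum_le_sum fun j _ => h1 j
        _ = K + 1 := by simp
    have hx64 : x < 2 ^ 6 := by
      have hlt : ⌊x⌋₊ < 2 ^ (K + 1) := Nat.lt_pow_succ_log_self one_lt_two _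
      have : 2 ^ (K + 1) ≤ 2 ^ 6 := Nat.pow_le_pow_right two_pos hK6
      have := (Nat.floor_lt hx0.le).1 (hlt.trans_le this)
      exact_mod_cast this
    have hL6 : L ≤ 4.16 := by
      have := Real.log_le_log hx0 hx64.le
      rw [Real.log_pow] at this
      push_cast at this
      linarith
    have hKle : (K : ℝ) ≤ 1.4428 * L := by nlinarith [(Nat.cast_nonneg K : (0 : ℝ) ≤ K)]
    have hLl : L - 1 ≤ L * Real.log L := by
      have h := Real.one_sub_inv_le_log_of_pos (x := L) (by linarith)
      have := mul_le_mul_of_nonneg_left h (by linarith : 0 ≤ L)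
      rwa [mul_sub, mul_one, mul_inv_cancel₀ (by linarith)] at this
    calc (Real.log 2 + L) * (1 + ∑ j ∈ range (K + 1), w j)
        ≤ (0.6932 + L) * (2 + 1.4428 * L) := by
          refine mul_le_mul (by linarith) (by linarith) ?_ (by linarith)
          have := Finset.sum_nonneg fun j (_ : j ∈ range (K + 1)) => h0 j
          linarith
      _ ≤ _ := by nlinarith
  · have hI : 2 ≤ K / 3 := by omega
    have hI0 : (0 : ℝ) < (K / 3 : ℕ) := by exact_mod_cast (by omega : 0 < K / 3)
    have hsum : ∑ j ∈ range (K + 1), w j ≤ 4.5 + 3 / Real.log 2 * Real.log L := by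
      have hsub : ∑ j ∈ range (K + 1), w j ≤ ∑ j ∈ range (3 * (K / 3 + 1)), w j :=
        Finset.sum_le_sum_of_subset_of_nonneg (Finset.range_mono (by omega)) fun j _ _ => h0 j
      have hb := sum_range_three_mul_le h1 h2 hI
      have hlogI : Real.log (K / 3 : ℕ) ≤ Real.log L - Real.log 2 := by
        rw [← Real.log_div (by linarith) two_ne_zero]
        refine Real.log_le_log hI0 ?_
        have : (3 : ℝ) * (K / 3 : ℕ) ≤ K := by exact_mod_cast Nat.mul_div_le K 3
        nlinarith
      have hmul : 3 / Real.log 2 * (Real.log (K / 3 : ℕ) - Real.log 2)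
          ≤ 3 / Real.log 2 * Real.log L - 6 := by
        calc 3 / Real.log 2 * (Real.log (K / 3 : ℕ) - Real.log 2)
            ≤ 3 / Real.log 2 * (Real.log L - Real.log 2 - Real.log 2) := by gcongr
          _ = _ := by field_simp; ring
      have : (0 : ℝ) < 12 / 2 ^ (K / 3 + 1) := by positivity
      linarith
    have hcoef : 3 / Real.log 2 ≤ 4.33 := by
      rw [div_le_iff₀ hl2p]
      linarith
    have hL4 : 4 ≤ L := by
      have : (6 : ℝ) ≤ K := by exact_mod_cast hK6
      nlinarith
    have hsum' : ∑ j ∈ range (K + 1), w j ≤ 4.5 + 4.33 * Real.log L := by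
      have := mul_le_mul_of_nonneg_right hcoef hnn
      linarith
    calc (Real.log 2 + L) * (1 + ∑ j ∈ range (K + 1), w j)
        ≤ (0.6932 + L) * (5.5 + 4.33 * Real.log L) := by
          refine mul_le_mul (by linarith) (by linarith) ?_ (by linarith)
          have := Finset.sum_nonneg fun j (_ : j ∈ range (K + 1)) => h0 j
          linarith
      _ ≤ _ := by nlinarith [mul_le_mul_of_nonneg_right hL4 hnn]

lemma sum_isPrimePow_inv_sub_le (x : ℝ) :
    ∑ n ∈ (Icc 1 ⌊2 * x⌋₊).filter
        (fun n : ℕ => (x + 1.5 ≤ (n : ℝ) ∧ (n : ℝ) < 2 * x) ∧ IsPrimePow n), 1 / ((n : ℝ) - x)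
      ≤ ∑ j ∈ range (Nat.log 2 ⌊x⌋₊ + 1),
        (((Ico (⌈x + 1.5⌉₊ + 2 ^ j - 1) (⌈x + 1.5⌉₊ + 2 ^ j - 1 + 2 ^ j)).filter fun n =>
          IsPrimePow n ∧ n < 2 * (⌈x + 1.5⌉₊ + 2 ^ j - 1)).card : ℝ) / 2 ^ j := by
  set m := ⌈x + 1.5⌉₊ with hm
  have hmx : x + 1.5 ≤ m := Nat.le_ceil _
  set A := (Icc 1 ⌊2 * x⌋₊).filter
    (fun n : ℕ => (x + 1.5 ≤ (n : ℝ) ∧ (n : ℝ) < 2 * x) ∧ IsPrimePow n) with hA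
  have hmem : ∀ n ∈ A, m ≤ n ∧ (n : ℝ) < 2 * x ∧ IsPrimePow n := fun n hn => by
    have h := (mem_filter.1 hn).2
    exact ⟨Nat.ceil_le.2 h.1.1, h.1.2, h.2⟩
  have hcast : ∀ n ∈ A, ((n - m + 1 : ℕ) : ℝ) = n - m + 1 := fun n hn => by
    rw [Nat.cast_add, Nat.cast_sub (hmem n hn).1, Nat.cast_one]
  have hmaps : ∀ n ∈ A, Nat.log 2 (n - m + 1) ∈ range (Nat.log 2 ⌊x⌋₊ + 1) := fun n hn => by
    rw [mem_range, Nat.lt_succ_iff]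
    refine Nat.log_mono_right (Nat.le_floor ?_)
    rw [hcast n hn]
    linarith [(hmem n hn).2.1]
  rw [← Finset.sum_fiberwise_of_maps_to hmaps]
  refine Finset.sum_le_sum fun j _ => ?_
  rw [div_eq_mul_one_div, ← nsmul_eq_mul]
  refine (Finset.sum_le_card_nsmul _ _ (1 / 2 ^ j) fun n hn => ?_).trans ?_
  · obtain ⟨hnA, hnj⟩ := mem_filter.1 hn
    have h2j : (2 : ℝ) ^ j ≤ ((n - m + 1 : ℕ) : ℝ) := by
      exact_mod_cast hnj ▸ Nat.pow_log_le_self 2 (Nat.succ_ne_zero (n - m))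
    rw [hcast n hnA] at h2j
    exact one_div_le_one_div_of_le (by positivity) (by linarith)
  · refine nsmul_le_nsmul_left (by positivity) (Finset.card_le_card fun n hn => ?_)
    obtain ⟨hnA, hnj⟩ := mem_filter.1 hn
    obtain ⟨h1, h2, h3⟩ := hmem n hnA
    have hlo : 2 ^ j ≤ n - m + 1 := hnj ▸ Nat.pow_log_le_self 2 (Nat.succ_ne_zero (n - m))
    have hhi : n - m + 1 < 2 ^ (j + 1) := hnj ▸ Nat.lt_pow_succ_log_self one_lt_two _
    have hpos : 1 ≤ 2 ^ j := Nat.one_le_two_pow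
    have hn2m : n < 2 * m := by
      have : (n : ℝ) < 2 * m := by linarith
      exact_mod_cast this
    rw [pow_succ] at hhi
    simp only [mem_filter, mem_Ico]
    exact ⟨by omega, h3, by omega⟩

lemma card_filter_Icc_floor_le {x : ℝ} (hx : 0 ≤ x) :
    (((Icc 1 ⌊2 * x⌋₊).filter
        (fun n : ℕ => x + 1.5 ≤ (n : ℝ) ∧ (n : ℝ) < 2 * x)).card : ℝ) ≤ x := by
  have hsub : (Icc 1 ⌊2 * x⌋₊).filter (fun n : ℕ => x + 1.5 ≤ (n : ℝ) ∧ (n : ℝ) < 2 * x)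
      ⊆ Ico ⌈x + 1.5⌉₊ ⌈2 * x⌉₊ := fun n hn => by
    have h := (mem_filter.1 hn).2
    exact mem_Ico.2 ⟨Nat.ceil_le.2 h.1, Nat.lt_ceil.2 h.2⟩
  have hcard := Finset.card_le_card hsub
  rw [Nat.card_Ico] at hcard
  refine (Nat.cast_le.2 hcard).trans ?_
  rcases le_total ⌈2 * x⌉₊ ⌈x + 1.5⌉₊ with h | h
  · simpa [Nat.sub_eq_zero_of_le h] using hx
  · rw [Nat.cast_sub h]
    linarith [Nat.le_ceil (x + 1.5), Nat.ceil_lt_add_one (by linarith : 0 ≤ 2 * x)]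

theorem sum_vonMangoldt_above_le_two_r3 (x : ℝ) (hx : 3 ≤ x) :
    ∑ n ∈ (Finset.Icc 1 ⌊2 * x⌋₊).filter
        (fun n : ℕ => x + 1.5 ≤ (n : ℝ) ∧ (n : ℝ) < 2 * x),
      Λ n / (1 - x / (n : ℝ)) ≤ 2 * r3 x := by
  have hx0 : 0 < x := by linarith
  have hlog : 0 < Real.log (2 * x) := Real.log_pos (by linarith)
  set m := ⌈x + 1.5⌉₊
  set w : ℕ → ℝ := fun j => (((Ico (m + 2 ^ j - 1) (m + 2 ^ j - 1 + 2 ^ j)).filter fun n =>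
      IsPrimePow n ∧ n < 2 * (m + 2 ^ j - 1)).card : ℝ) / 2 ^ j with hw
  set F := (Finset.Icc 1 ⌊2 * x⌋₊).filter
    (fun n : ℕ => x + 1.5 ≤ (n : ℝ) ∧ (n : ℝ) < 2 * x) with hF
  have hterm : ∀ n ∈ F, Λ n / (1 - x / (n : ℝ))
      ≤ Real.log (2 * x) + Real.log (2 * x) * x *
        (if IsPrimePow n then 1 / ((n : ℝ) - x) else 0) := fun n hn => by
    have h := (mem_filter.1 hn).2
    have hn0 : (0 : ℝ) < n := by linarith
    have hnx : 0 < (n : ℝ) - x := by linarith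
    split_ifs with hpp
    · have hΛ : Λ n ≤ Real.log (2 * x) :=
        vonMangoldt_le_log.trans (Real.log_le_log hn0 h.2.le)
      have heq : Λ n / (1 - x / (n : ℝ)) = Λ n * (1 + x * (1 / (n - x))) := by
        have : 1 - x / (n : ℝ) ≠ 0 := by
          rw [one_sub_div hn0.ne']
          exact (div_pos hnx hn0).ne'
        field_simp
        ring
      rw [heq]
      have hfac : 0 ≤ 1 + x * (1 / ((n : ℝ) - x)) := by positivity
      linarith [mul_le_mul_of_nonneg_right hΛ hfac]
    · rw [vonMangoldt_eq_zero_iff.2 hpp]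
      simp [hlog.le]
  have hsum : ∑ n ∈ F, (if IsPrimePow n then 1 / ((n : ℝ) - x) else 0)
      ≤ ∑ j ∈ range (Nat.log 2 ⌊x⌋₊ + 1), w j := by
    rw [← Finset.sum_filter, hF, Finset.filter_filter]
    exact sum_isPrimePow_inv_sub_le x
  have hw1 : ∀ j, w j ≤ 1 := fun j => by
    rw [hw, div_le_one (by positivity)]
    have h := Finset.card_filter_le (Ico (m + 2 ^ j - 1) (m + 2 ^ j - 1 + 2 ^ j))
      fun n => IsPrimePow n ∧ n < 2 * (m + 2 ^ j - 1)
    rw [Nat.card_Ico, Nat.add_sub_cancel_left] at h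
    exact_mod_cast h
  have hmain := log_two_mul_mul_le hx (fun j => by positivity) hw1
    fun i j hi hij => card_isPrimePow_Ico_two_pow_div_le hi hij _
  calc ∑ n ∈ F, Λ n / (1 - x / (n : ℝ))
      ≤ ∑ n ∈ F, (Real.log (2 * x) + Real.log (2 * x) * x *
        (if IsPrimePow n then 1 / ((n : ℝ) - x) else 0)) := Finset.sum_le_sum hterm
    _ = F.card * Real.log (2 * x) + Real.log (2 * x) * x *
        ∑ n ∈ F, (if IsPrimePow n then 1 / ((n : ℝ) - x) else 0) := by
        rw [Finset.sum_add_distrib, ← mul_sum, Finset.sum_const, nsmul_eq_mul]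
    _ ≤ x * Real.log (2 * x) + Real.log (2 * x) * x *
        ∑ j ∈ range (Nat.log 2 ⌊x⌋₊ + 1), w j := by
        gcongr
        exact card_filter_Icc_floor_le hx0.le
    _ = x * (Real.log (2 * x) * (1 + ∑ j ∈ range (Nat.log 2 ⌊x⌋₊ + 1), w j)) := by ring
    _ ≤ x * (2 * (Real.log x * (3.6 + (46 / 15) * Real.log (Real.log x)) + 2)) :=
        mul_le_mul_of_nonneg_left hmain hx0.le
    _ ≤ 2 * r3 x := by linarith [le_r3 hx]
end

section
/- Let Q ≥ 1 be real. Then Σ_{q ≤ Q} 1/φ(q) ≤ c₁ (1 + log Q), where c₁ = Π_p (1 + 1/(p(p-1))), the product over all primes. -/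
open Real Finset

/-- `c₁ = Π_p (1 + 1/(p(p-1)))`, the product over all primes. -/
noncomputable def c1 : ℝ := ∏' p : Nat.Primes, (1 + 1 / ((p : ℝ) * ((p : ℝ) - 1)))

theorem one_div_totient_eq_sum_powerset (q : ℕ) :
    (1 : ℝ) / Nat.totient q =
      1 / q * ∑ s ∈ q.primeFactors.powerset, ∏ p ∈ s, 1 / ((p : ℝ) - 1) := by
  have h : (Nat.totient q : ℝ) = q * ∏ p ∈ q.primeFactors, (1 - (p : ℝ)⁻¹) := by
    have := congrArg (Rat.cast : ℚ → ℝ) (Nat.totient_eq_mul_prod_factors q)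
    push_cast at this
    exact this
  rw [← Finset.prod_one_add, h, one_div_mul_eq_div, one_div, mul_inv, ← Finset.prod_inv_distrib,
    mul_comm, ← div_eq_mul_inv]
  congr 1
  refine Finset.prod_congr rfl fun p hp => ?_
  have h2 : (1 : ℝ) < p := by exact_mod_cast (Nat.prime_of_mem_primeFactors hp).one_lt
  have h0 : (p : ℝ) ≠ 0 := by positivity
  have h1 : (p : ℝ) - 1 ≠ 0 := (sub_pos.2 h2).ne'
  have h3 : 1 - (p : ℝ)⁻¹ = (p - 1) / p := by field_simp
  rw [h3]
  field_simp
  ring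

theorem sum_one_div_of_dvd_le {d : ℕ} (hd : 0 < d) (N : ℕ) :
    ∑ q ∈ Finset.Icc 1 N with d ∣ q, (1 : ℝ) / q ≤
      1 / d * ∑ m ∈ Finset.Icc 1 N, (1 : ℝ) / m := by
  have hsub : {q ∈ Finset.Icc 1 N | d ∣ q} ⊆ (Finset.Icc 1 N).image (d * ·) := by
    intro q hq
    obtain ⟨hq, m, rfl⟩ := Finset.mem_filter.1 hq
    rw [Finset.mem_Icc] at hq
    refine Finset.mem_image.2 ⟨m, Finset.mem_Icc.2 ⟨?_, ?_⟩, rfl⟩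
    · exact Nat.pos_of_mul_pos_left hq.1
    · exact (Nat.le_mul_of_pos_left m hd).trans hq.2
  refine (Finset.sum_le_sum_of_subset_of_nonneg hsub fun _ _ _ => by positivity).trans_eq ?_
  rw [Finset.sum_image fun a _ b _ h => Nat.eq_of_mul_eq_mul_left hd h, Finset.mul_sum]
  refine Finset.sum_congr rfl fun m _ => ?_
  push_cast
  rw [one_div_mul_one_div]

theorem one_div_mul_sub_one_nonneg (p : Nat.Primes) :
    0 ≤ 1 / ((p : ℝ) * ((p : ℝ) - 1)) := by
  have h : (1 : ℝ) < p := by exact_mod_cast p.2.one_lt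
  have := sub_pos.2 h
  positivity

theorem summable_primes_one_div_mul_sub_one :
    Summable fun p : Nat.Primes => 1 / ((p : ℝ) * ((p : ℝ) - 1)) := by
  have hs : Summable fun p : Nat.Primes => 2 * (1 / (p : ℝ) ^ 2) :=
    ((Real.summable_one_div_nat_pow.2 one_lt_two).comp_injective
      Nat.Primes.coe_nat_injective).mul_left 2
  refine hs.of_nonneg_of_le one_div_mul_sub_one_nonneg fun p => ?_
  have h : (2 : ℝ) ≤ p := by exact_mod_cast p.2.two_le
  rw [mul_one_div, div_le_div_iff₀ (by nlinarith) (by positivity)]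
  nlinarith

theorem prod_primes_le_c1 (s : Finset Nat.Primes) :
    ∏ p ∈ s, (1 + 1 / ((p : ℝ) * ((p : ℝ) - 1))) ≤ c1 := by
  have hm := Real.multipliable_one_add_of_summable summable_primes_one_div_mul_sub_one
  refine ge_of_tendsto hm.hasProd ?_
  filter_upwards [Filter.eventually_ge_atTop s] with t hst
  have hone (p : Nat.Primes) : 1 ≤ 1 + 1 / ((p : ℝ) * ((p : ℝ) - 1)) :=
    le_add_of_nonneg_right (one_div_mul_sub_one_nonneg p)
  exact Finset.prod_le_prod_of_subset_of_one_le hst (fun p _ => zero_le_one.trans (hone p))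
    fun p _ _ => hone p

theorem sum_inv_totient_le (Q : ℝ) (hQ : 1 ≤ Q) :
    ∑ q ∈ Finset.Icc 1 ⌊Q⌋₊, (1 : ℝ) / (Nat.totient q) ≤ c1 * (1 + Real.log Q) := by
  set N := ⌊Q⌋₊
  set P := {p ∈ Finset.Icc 1 N | p.Prime} with hP
  set H : ℝ := ∑ m ∈ Finset.Icc 1 N, (1 : ℝ) / m with hH
  have hH0 : 0 ≤ H := Finset.sum_nonneg fun _ _ => by positivity
  have hHQ : H ≤ 1 + Real.log Q := by
    have := harmonic_floor_le_one_add_log Q hQ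
    rw [harmonic_eq_sum_Icc] at this
    push_cast at this
    simpa only [hH, one_div] using this
  have hprime {s : Finset ℕ} (hs : s ∈ P.powerset) {p : ℕ} (hp : p ∈ s) : p.Prime :=
    (Finset.mem_filter.1 (Finset.mem_powerset.1 hs hp)).2
  calc ∑ q ∈ Finset.Icc 1 N, (1 : ℝ) / (Nat.totient q)
      = ∑ q ∈ Finset.Icc 1 N, ∑ s ∈ q.primeFactors.powerset,
          1 / (q : ℝ) * ∏ p ∈ s, 1 / ((p : ℝ) - 1) := by
        simp_rw [one_div_totient_eq_sum_powerset, Finset.mul_sum]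
    _ = ∑ s ∈ P.powerset, ∑ q ∈ Finset.Icc 1 N with s ⊆ q.primeFactors,
          1 / (q : ℝ) * ∏ p ∈ s, 1 / ((p : ℝ) - 1) := by
        refine Finset.sum_comm' fun q s => ?_
        simp only [Finset.mem_powerset, Finset.mem_filter]
        refine ⟨fun ⟨hq, hs⟩ => ⟨⟨hq, hs⟩, fun p hp => ?_⟩, fun h => h.1⟩
        have hpq := hs hp
        have hpp := Nat.prime_of_mem_primeFactors hpq
        exact Finset.mem_filter.2 ⟨Finset.mem_Icc.2 ⟨hpp.one_le,
          (Nat.le_of_mem_primeFactors hpq).trans (Finset.mem_Icc.1 hq).2⟩, hpp⟩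
    _ ≤ ∑ s ∈ P.powerset, (∏ p ∈ s, 1 / ((p : ℝ) * ((p : ℝ) - 1))) * H := by
        refine Finset.sum_le_sum fun s hs => ?_
        have hd : 0 < ∏ p ∈ s, p := Finset.prod_pos fun p hp => (hprime hs hp).pos
        have hg : 0 ≤ ∏ p ∈ s, 1 / ((p : ℝ) - 1) := Finset.prod_nonneg fun p hp => by
          have : (1 : ℝ) ≤ p := by exact_mod_cast (hprime hs hp).one_le
          exact one_div_nonneg.2 (sub_nonneg.2 this)
        have hsub : {q ∈ Finset.Icc 1 N | s ⊆ q.primeFactors} ⊆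
            {q ∈ Finset.Icc 1 N | ∏ p ∈ s, p ∣ q} :=
          Finset.monotone_filter_right _ fun q _ hq =>
            (Finset.prod_dvd_prod_of_subset _ _ _ hq).trans (Nat.prod_primeFactors_dvd q)
        rw [← Finset.sum_mul]
        refine (mul_le_mul_of_nonneg_right
          ((Finset.sum_le_sum_of_subset_of_nonneg hsub fun _ _ _ => by positivity).trans
            (sum_one_div_of_dvd_le hd N)) hg).trans_eq ?_
        simp_rw [← one_div_mul_one_div, Finset.prod_mul_distrib]
        simp only [one_div, Finset.prod_inv_distrib, Nat.cast_prod, hH]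
        ring
    _ = (∏ p ∈ P, (1 + 1 / ((p : ℝ) * ((p : ℝ) - 1)))) * H := by
        rw [← Finset.sum_mul, Finset.prod_one_add]
    _ ≤ c1 * (1 + Real.log Q) := by
        have hc : ∏ p ∈ P, (1 + 1 / ((p : ℝ) * ((p : ℝ) - 1))) ≤ c1 := by
          rw [hP, ← Finset.prod_subtype_eq_prod_filter]
          exact prod_primes_le_c1 _
        have hc0 : 0 ≤ c1 := by simpa using zero_le_one.trans (prod_primes_le_c1 ∅)
        exact mul_le_mul hc hHQ hH0 hc0
end
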